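/- arXiv:1401.0499 — 2 statements merged into one kernel-verified Lean document; each statement's English description precedes it below -/
import Mathlib

section
/- Let r ≥ 3 be an integer and let G = BB(1,r) be the Brady–Bridson snowflake group: the group presented by generators a, b, s, t and relators a b a⁻¹ b⁻¹, s⁻¹ a s (aʳ b)⁻¹, and t⁻¹ a t (aʳ b⁻¹)⁻¹. Then G admits a cocompact, growth tight action: there exist a metric space X that is proper and geodesic, an action of G on X by isometries that is properly discontinuous and cocompact (there is a compact K ⊆ X with ⋃_{g∈G} g·K = X), and a basepoint o ∈ X, such that δ_{G/Γ} < δ_G for every infinite normal subgroup Γ of G. -/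
open Filter Metric
open scoped ENNReal

section Defs

variable {G : Type*} {X : Type*} [Group G] [MetricSpace X] [MulAction G X]

/-- A geodesic from `x` to `y`: an isometric parameterization of `[0, dist x y]`. -/
def GeodesicFromTo (γ : ℝ → X) (x y : X) : Prop :=
  γ 0 = x ∧ γ (dist x y) = y ∧
    ∀ s ∈ Set.Icc (0 : ℝ) (dist x y), ∀ t ∈ Set.Icc (0 : ℝ) (dist x y),
      dist (γ s) (γ t) = |s - t|

/-- A geodesic metric space. -/
def GeodesicSpace (X : Type*) [MetricSpace X] : Prop :=
  ∀ x y : X, ∃ γ : ℝ → X, GeodesicFromTo γ x y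

/-- The action of `G` on `X` is by isometries. -/
def IsometricAction (G X : Type*) [Group G] [MetricSpace X] [MulAction G X] : Prop :=
  ∀ (g : G) (x y : X), dist (g • x) (g • y) = dist x y

/-- The action of `G` on `X` is properly discontinuous. -/
def ProperlyDiscontinuousAction (G X : Type*) [Group G] [MetricSpace X] [MulAction G X] : Prop :=
  ∀ K : Set X, IsCompact K → {g : G | ((g • ·) '' K ∩ K).Nonempty}.Finite

/-- `G` is non-elementary: no cyclic subgroup has finite index. -/
def NonElementary (G : Type*) [Group G] : Prop :=
  ∀ g : G, (Subgroup.zpowers g).index = 0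

/-- Growth exponent of a subset `A ⊆ G`, with respect to basepoint `o`. -/
noncomputable def growthExp (o : X) (A : Set G) : ℝ≥0∞ :=
  Filter.limsup (fun r : ℝ =>
    ENNReal.ofReal (Real.log (Nat.card {g : G // g ∈ A ∧ dist o (g • o) ≤ r}) / r))
    Filter.atTop

/-- Growth exponent of the quotient `G ⧸ Γ` with the induced pseudo-metric. -/
noncomputable def quotGrowthExp (o : X) (Γ : Subgroup G) : ℝ≥0∞ :=
  Filter.limsup (fun r : ℝ =>
    ENNReal.ofReal (Real.log (Nat.card
      {q : G ⧸ Γ // ∃ g : G, QuotientGroup.mk g = q ∧ (⨅ γ : Γ, dist o ((g * γ) • o)) ≤ r}) / r))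
    Filter.atTop

/-- A growth tight action. -/
def GrowthTight (G : Type*) [Group G] {X : Type*} [MetricSpace X] [MulAction G X] (o : X) : Prop :=
  ∀ Γ : Subgroup G, Γ.Normal → (Γ : Set G).Infinite →
    quotGrowthExp o Γ < growthExp o (Set.univ : Set G)

/-- The `⟨h⟩`-orbit of the basepoint. -/
def zOrbit (o : X) (h : G) : Set X := Set.range fun i : ℤ => h ^ i • o

/-- Nearest point projection to a subset. -/
def nprojSet (S : Set X) (x : X) : Set X := {a ∈ S | dist x a = Metric.infDist x S}

/-- `h` is a strongly contracting element for `G ↷ X`. -/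
def StronglyContractingElem (o : X) (h : G) : Prop :=
  ¬ IsOfFinOrder h ∧
  (∃ M C : ℝ, 1 ≤ M ∧ 0 ≤ C ∧ ∀ i j : ℤ,
    (1 / M) * |(i : ℝ) - (j : ℝ)| - C ≤ dist (h ^ i • o) (h ^ j • o) ∧
    dist (h ^ i • o) (h ^ j • o) ≤ M * |(i : ℝ) - (j : ℝ)| + C) ∧
  (∃ C : ℝ, 0 ≤ C ∧ ∀ x y : X,
    dist x y < Metric.infDist x (zOrbit o h) - C →
    Metric.diam (nprojSet (zOrbit o h) x ∪ nprojSet (zOrbit o h) y) ≤ C)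

end Defs

/-- The relators of the Brady–Bridson snowflake group `BB(1,r)`, on generators
`a = of 0`, `b = of 1`, `s = of 2`, `t = of 3`. -/
def snowflakeRels (r : ℕ) : Set (FreeGroup (Fin 4)) :=
  {FreeGroup.of 0 * FreeGroup.of 1 * (FreeGroup.of 0)⁻¹ * (FreeGroup.of 1)⁻¹,
   (FreeGroup.of 2)⁻¹ * FreeGroup.of 0 * FreeGroup.of 2 *
     (FreeGroup.of 0 ^ r * FreeGroup.of 1)⁻¹,
   (FreeGroup.of 3)⁻¹ * FreeGroup.of 0 * FreeGroup.of 3 *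
     (FreeGroup.of 0 ^ r * (FreeGroup.of 1)⁻¹)⁻¹}

/-! ### Word length -/

section WordLength

variable {G : Type*} [Group G]

/-- `S` is a finite symmetric generating set of `G` that does not contain the identity. -/
structure IsSymmGenSet (S : Set G) : Prop where
  finite : S.Finite
  inv_mem : ∀ x ∈ S, x⁻¹ ∈ S
  one_notMem : (1 : G) ∉ S
  exists_word : ∀ g : G, ∃ l : List G, (∀ x ∈ l, x ∈ S) ∧ l.prod = g

/-- The length of a shortest word over `S` that represents `g`. -/
noncomputable def wordLength (S : Set G) (g : G) : ℕ :=
  sInf {n | ∃ l : List G, (∀ x ∈ l, x ∈ S) ∧ l.prod = g ∧ l.length = n}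

variable {S : Set G}

theorem wordLength_prod_le {l : List G} (hl : ∀ x ∈ l, x ∈ S) :
    wordLength S l.prod ≤ l.length :=
  Nat.sInf_le ⟨l, hl, rfl, rfl⟩

theorem wordLength_one : wordLength S (1 : G) = 0 :=
  Nat.le_zero.1 (wordLength_prod_le (l := []) (by simp))

theorem wordLength_le_one {x : G} (hx : x ∈ S) : wordLength S x ≤ 1 := by
  simpa using wordLength_prod_le (S := S) (l := [x]) (by simpa using hx)

namespace IsSymmGenSet

theorem exists_geodesic_word (hS : IsSymmGenSet S) (g : G) :
    ∃ l : List G, (∀ x ∈ l, x ∈ S) ∧ l.prod = g ∧ l.length = wordLength S g := by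
  obtain ⟨l, hl, h⟩ := hS.exists_word g
  exact Nat.sInf_mem (s := {n | ∃ l : List G, (∀ x ∈ l, x ∈ S) ∧ l.prod = g ∧ l.length = n})
    ⟨_, l, hl, h, rfl⟩

theorem wordLength_mul_le (hS : IsSymmGenSet S) (g h : G) :
    wordLength S (g * h) ≤ wordLength S g + wordLength S h := by
  obtain ⟨l, hl, rfl, hl'⟩ := hS.exists_geodesic_word g
  obtain ⟨m, hm, rfl, hm'⟩ := hS.exists_geodesic_word h
  rw [← hl', ← hm', ← List.length_append, ← List.prod_append]
  exact wordLength_prod_le fun x hx => (List.mem_append.1 hx).elim (hl x) (hm x)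

theorem wordLength_inv_le (hS : IsSymmGenSet S) (g : G) : wordLength S g⁻¹ ≤ wordLength S g := by
  obtain ⟨l, hl, rfl, hl'⟩ := hS.exists_geodesic_word g
  rw [← hl', List.prod_inv_reverse]
  refine (wordLength_prod_le fun x hx => ?_).trans_eq (by simp)
  simp only [List.mem_reverse, List.mem_map] at hx
  obtain ⟨y, hy, rfl⟩ := hx
  exact hS.inv_mem _ (hl y hy)

theorem wordLength_inv (hS : IsSymmGenSet S) (g : G) : wordLength S g⁻¹ = wordLength S g :=
  (hS.wordLength_inv_le g).antisymm (by simpa using hS.wordLength_inv_le g⁻¹)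

theorem eq_one_of_wordLength_eq_zero (hS : IsSymmGenSet S)
    {g : G} (h : wordLength S g = 0) : g = 1 := by
  obtain ⟨l, -, rfl, hl'⟩ := hS.exists_geodesic_word g
  rw [List.length_eq_zero_iff.1 (hl'.trans h), List.prod_nil]

theorem wordLength_eq_one (hS : IsSymmGenSet S) {x : G} (hx : x ∈ S) : wordLength S x = 1 := by
  refine (wordLength_le_one hx).antisymm (Nat.one_le_iff_ne_zero.2 fun h => ?_)
  exact hS.one_notMem (hS.eq_one_of_wordLength_eq_zero h ▸ hx)

/-- A nontrivial element is a letter times a shorter element. -/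
theorem exists_eq_mul (hS : IsSymmGenSet S) {g : G} {n : ℕ} (h : wordLength S g = n + 1) :
    ∃ x ∈ S, ∃ k, g = x * k ∧ wordLength S k = n := by
  obtain ⟨l, hl, rfl, hl'⟩ := hS.exists_geodesic_word g
  rcases l with _ | ⟨x, l⟩
  · rw [List.prod_nil, wordLength_one] at h
    omega
  simp only [List.mem_cons, forall_eq_or_imp] at hl
  refine ⟨x, hl.1, l.prod, by simp, ?_⟩
  have h1 := wordLength_prod_le hl.2
  have h2 := hS.wordLength_mul_le x l.prod
  have h3 := wordLength_le_one hl.1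
  simp only [List.length_cons, List.prod_cons] at *
  omega

theorem exists_mul_of_le_add (hS : IsSymmGenSet S) {g : G} {m n : ℕ} (h : wordLength S g ≤ m + n) :
    ∃ g₁ g₂, g = g₁ * g₂ ∧ wordLength S g₁ ≤ m ∧ wordLength S g₂ ≤ n := by
  obtain ⟨l, hl, rfl, hl'⟩ := hS.exists_geodesic_word g
  refine ⟨(l.take m).prod, (l.drop m).prod, (List.prod_take_mul_prod_drop ..).symm, ?_, ?_⟩
  · refine (wordLength_prod_le fun x hx => hl x (List.mem_of_mem_take hx)).trans ?_
    simp
  · refine (wordLength_prod_le fun x hx => hl x (List.mem_of_mem_drop hx)).trans ?_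
    simp; omega

theorem finite_ball (hS : IsSymmGenSet S) (n : ℕ) : {g : G | wordLength S g ≤ n}.Finite := by
  induction n with
  | zero =>
    refine (Set.finite_singleton (1 : G)).subset fun g hg => ?_
    exact hS.eq_one_of_wordLength_eq_zero (Nat.le_zero.1 hg)
  | succ n ih =>
    have hball : {g : G | wordLength S g ≤ 1} ⊆ insert 1 S := fun g hg => by
      rcases Nat.le_one_iff_eq_zero_or_eq_one.1 hg with h | h
      · exact Or.inl (hS.eq_one_of_wordLength_eq_zero h)
      · obtain ⟨x, hx, k, rfl, hk⟩ := hS.exists_eq_mul h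
        rw [hS.eq_one_of_wordLength_eq_zero hk, mul_one]
        exact Or.inr hx
    refine (Set.Finite.image2 (· * ·) ih ((hS.finite.insert 1).subset hball)).subset ?_
    intro g hg
    obtain ⟨g₁, g₂, rfl, h₁, h₂⟩ := hS.exists_mul_of_le_add hg
    exact ⟨g₁, h₁, g₂, h₂, rfl⟩

end IsSymmGenSet

/-- An integer-valued function that decreases along a word decreases at one of its letters. -/
theorem List.exists_letter_lt {α : Type*} [Monoid α] (f : α → ℤ) (l : List α)
    (h : f l.prod < f 1) :
    ∃ l₁ x l₂, l = l₁ ++ x :: l₂ ∧ f (l₁.prod * x) < f l₁.prod := by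
  induction l using List.reverseRecOn with
  | nil => simp at h
  | append_singleton l x ih =>
    by_cases hl : f l.prod < f 1
    · obtain ⟨l₁, y, l₂, rfl, hy⟩ := ih hl
      exact ⟨l₁, y, l₂ ++ [x], by simp, hy⟩
    · refine ⟨l, x, [], rfl, ?_⟩
      simp only [List.prod_append, List.prod_singleton] at h
      omega

/-- An integer-valued function that takes a smaller value at `g` than at `1` decreases at some
letter of a shortest word for `g`. -/
theorem IsSymmGenSet.exists_letter_lt (hS : IsSymmGenSet S) (f : G → ℤ) {g : G}
    (h : f g < f 1) :
    ∃ g₁, ∃ x ∈ S, ∃ g₂, g = g₁ * x * g₂ ∧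
      wordLength S g₁ + 1 + wordLength S g₂ ≤ wordLength S g ∧ f (g₁ * x) < f g₁ := by
  obtain ⟨l, hl, rfl, hl'⟩ := hS.exists_geodesic_word g
  obtain ⟨l₁, x, l₂, rfl, hx⟩ := l.exists_letter_lt f h
  refine ⟨l₁.prod, x, hl x (by simp), l₂.prod, by simp [mul_assoc], ?_, hx⟩
  have h₁ := wordLength_prod_le (S := S) (l := l₁) fun y hy => hl y (by simp [hy])
  have h₂ := wordLength_prod_le (S := S) (l := l₂) fun y hy => hl y (by simp [hy])
  simp only [List.length_append, List.length_cons] at hl'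
  omega

end WordLength

/-! ### The Cayley graph as a geodesic space -/

section CayleyGraph

variable {G : Type*} {S : Set G}

/-- A point at position `pos` on the edge of the Cayley graph from `base` to `base * dir`. -/
structure CayleyPoint {G : Type*} (S : Set G) where
  base : G
  dir : S
  pos : unitInterval

namespace CayleyPoint

/-- The distances of a point to the endpoints of its edge. -/
noncomputable def cost (p : CayleyPoint S) : Bool → ℝ
  | false => p.pos
  | true => 1 - p.pos

theorem cost_nonneg (p : CayleyPoint S) (i : Bool) : 0 ≤ p.cost i := by
  cases i
  · exact p.pos.2.1
  · exact sub_nonneg.2 p.pos.2.2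

/-- The two points lie on the same edge. -/
def SameEdge (p q : CayleyPoint S) : Prop := p.base = q.base ∧ p.dir = q.dir

theorem SameEdge.cost_le {p q : CayleyPoint S} (i : Bool) :
    p.cost i ≤ |(p.pos : ℝ) - q.pos| + q.cost i := by
  cases i
  · have := le_abs_self ((p.pos : ℝ) - q.pos); simp only [cost]; linarith
  · have := neg_abs_le ((p.pos : ℝ) - q.pos); simp only [cost]; linarith

theorem SameEdge.symm {p q : CayleyPoint S} (h : SameEdge p q) : SameEdge q p :=
  ⟨h.1.symm, h.2.symm⟩

variable [Group G]

/-- The two endpoints of the edge that carries a point. -/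
def endpt (p : CayleyPoint S) : Bool → G
  | false => p.base
  | true => p.base * p.dir

/-- The length of a shortest path from `p` to `q` through the endpoints `i` and `j`. -/
noncomputable def via (p q : CayleyPoint S) (i j : Bool) : ℝ :=
  p.cost i + wordLength S ((p.endpt i)⁻¹ * q.endpt j) + q.cost j

/-- The length of a shortest path from `p` to `q` through vertices. -/
noncomputable def viaMin (p q : CayleyPoint S) : ℝ :=
  min (min (via p q false false) (via p q false true))
    (min (via p q true false) (via p q true true))

theorem viaMin_le (p q : CayleyPoint S) (i j : Bool) : viaMin p q ≤ via p q i j := by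
  cases i <;> cases j <;> simp [viaMin]

theorem exists_viaMin_eq (p q : CayleyPoint S) : ∃ i j, viaMin p q = via p q i j := by
  unfold viaMin
  rcases min_choice (min (via p q false false) (via p q false true))
    (min (via p q true false) (via p q true true)) with h | h <;> rw [h]
  · rcases min_choice (via p q false false) (via p q false true) with h | h <;>
      exact ⟨_, _, h⟩
  · rcases min_choice (via p q true false) (via p q true true) with h | h <;>
      exact ⟨_, _, h⟩

open Classical in
/-- The path metric of the Cayley graph. -/
noncomputable def pathDist (p q : CayleyPoint S) : ℝ :=
  if SameEdge p q then |(p.pos : ℝ) - q.pos| else viaMin p q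

theorem SameEdge.pathDist_eq {p q : CayleyPoint S} (h : SameEdge p q) :
    pathDist p q = |(p.pos : ℝ) - q.pos| := if_pos h

theorem SameEdge.endpt_eq {p q : CayleyPoint S} (h : SameEdge p q) : p.endpt = q.endpt := by
  funext i; cases i <;> simp [endpt, h.1, h.2]

theorem via_comm (hS : IsSymmGenSet S) (p q : CayleyPoint S) (i j : Bool) :
    via p q i j = via q p j i := by
  rw [via, via, ← hS.wordLength_inv]
  simp only [mul_inv_rev, inv_inv]
  ring

theorem wordLength_endpt_le (hS : IsSymmGenSet S) (p : CayleyPoint S) (i j : Bool) :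
    (wordLength S ((p.endpt i)⁻¹ * p.endpt j) : ℝ) ≤ p.cost i + p.cost j := by
  have h1 : (wordLength S (p.dir : G) : ℝ) = 1 := mod_cast hS.wordLength_eq_one p.dir.2
  have h2 : (wordLength S (p.dir : G)⁻¹ : ℝ) = 1 := by rw [hS.wordLength_inv, h1]
  have := p.cost_nonneg
  cases i <;> cases j <;> simp [endpt, cost, wordLength_one, h1, h2, p.pos.2.1, p.pos.2.2]

theorem SameEdge.dist_le_via (hS : IsSymmGenSet S) {p q : CayleyPoint S} (h : SameEdge p q)
    (i j : Bool) : |(p.pos : ℝ) - q.pos| ≤ via p q i j := by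
  have hd : (p.dir : G) = q.dir := by rw [h.2]
  have h1 : (wordLength S (q.dir : G) : ℝ) = 1 := mod_cast hS.wordLength_eq_one q.dir.2
  have h2 : (wordLength S (q.dir : G)⁻¹ : ℝ) = 1 := by rw [hS.wordLength_inv, h1]
  have a1 := p.pos.2.1
  have a2 := p.pos.2.2
  have a3 := q.pos.2.1
  have a4 := q.pos.2.2
  rw [abs_le]
  cases i <;> cases j <;>
    simp only [via, cost, endpt, h.1, hd, h1, h2, inv_mul_cancel, wordLength_one,
      inv_mul_cancel_left, mul_inv_rev, mul_assoc, mul_one, Nat.cast_zero] <;>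
    constructor <;> linarith

theorem pathDist_le_via (hS : IsSymmGenSet S) (p q : CayleyPoint S) (i j : Bool) :
    pathDist p q ≤ via p q i j := by
  by_cases h : SameEdge p q
  · exact h.pathDist_eq.trans_le (h.dist_le_via hS i j)
  · exact (if_neg h).trans_le (viaMin_le p q i j)

theorem pathDist_cases (p q : CayleyPoint S) :
    SameEdge p q ∨ ∃ i j, pathDist p q = via p q i j := by
  by_cases h : SameEdge p q
  · exact Or.inl h
  · obtain ⟨i, j, hij⟩ := exists_viaMin_eq p q
    exact Or.inr ⟨i, j, (if_neg h).trans hij⟩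

theorem pathDist_comm (hS : IsSymmGenSet S) (p q : CayleyPoint S) :
    pathDist p q = pathDist q p := by
  have key : ∀ p q : CayleyPoint S, pathDist p q ≤ pathDist q p := fun p q => by
    rcases pathDist_cases q p with h | ⟨i, j, h⟩
    · rw [h.pathDist_eq, h.symm.pathDist_eq, abs_sub_comm]
    · rw [h, via_comm hS]
      exact pathDist_le_via hS p q j i
  exact (key p q).antisymm (key q p)

theorem pathDist_triangle (hS : IsSymmGenSet S) (p q s : CayleyPoint S) :
    pathDist p s ≤ pathDist p q + pathDist q s := by
  have tri : ∀ x y z : G, (wordLength S (x⁻¹ * z) : ℝ) ≤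
      wordLength S (x⁻¹ * y) + wordLength S (y⁻¹ * z) := fun x y z => by
    have := hS.wordLength_mul_le (x⁻¹ * y) (y⁻¹ * z)
    rw [mul_assoc, mul_inv_cancel_left] at this
    exact mod_cast this
  rcases pathDist_cases p q with h | ⟨i, j, h⟩ <;>
    rcases pathDist_cases q s with h' | ⟨k, l, h'⟩
  · have : SameEdge p s := ⟨h.1.trans h'.1, h.2.trans h'.2⟩
    rw [this.pathDist_eq, h.pathDist_eq, h'.pathDist_eq]
    exact abs_sub_le _ _ _
  · refine (pathDist_le_via hS p s k l).trans ?_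
    rw [h.pathDist_eq, h', via, via, h.endpt_eq]
    linarith [SameEdge.cost_le (p := p) (q := q) k]
  · refine (pathDist_le_via hS p s i j).trans ?_
    rw [h'.pathDist_eq, h, via, via, h'.endpt_eq]
    have := SameEdge.cost_le (p := s) (q := q) j
    rw [abs_sub_comm] at this
    linarith
  · refine (pathDist_le_via hS p s i l).trans ?_
    rw [h, h']
    simp only [via]
    linarith [tri (p.endpt i) (q.endpt j) (s.endpt l),
      tri (q.endpt j) (q.endpt k) (s.endpt l), wordLength_endpt_le hS q j k]

/-- The pseudometric on the disjoint union of the edges. -/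
@[reducible]
noncomputable def pseudoMetricSpace (hS : IsSymmGenSet S) :
    PseudoMetricSpace (CayleyPoint S) where
  dist := pathDist
  dist_self p := by rw [SameEdge.pathDist_eq ⟨rfl, rfl⟩]; simp
  dist_comm := pathDist_comm hS
  dist_triangle := pathDist_triangle hS

instance : MulAction G (CayleyPoint S) where
  smul g p := ⟨g * p.base, p.dir, p.pos⟩
  one_smul p := by
    change CayleyPoint.mk (1 * p.base) p.dir p.pos = p
    rw [one_mul]
  mul_smul g h p := by
    change CayleyPoint.mk (g * h * p.base) p.dir p.pos = ⟨g * (h * p.base), p.dir, p.pos⟩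
    rw [mul_assoc]

theorem smul_mk (g h : G) (x : S) (τ : unitInterval) :
    g • (⟨h, x, τ⟩ : CayleyPoint S) = ⟨g * h, x, τ⟩ := rfl

theorem pathDist_smul (g : G) (p q : CayleyPoint S) :
    pathDist (g • p) (g • q) = pathDist p q := by
  obtain ⟨x, d, τ⟩ := p
  obtain ⟨y, e, ρ⟩ := q
  have hvia : ∀ i j, via (g • ⟨x, d, τ⟩ : CayleyPoint S) (g • ⟨y, e, ρ⟩) i j =
      via ⟨x, d, τ⟩ ⟨y, e, ρ⟩ i j := by
    intro i j
    cases i <;> cases j <;> simp [via, endpt, cost, smul_mk, mul_assoc]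
  have hedge : SameEdge (g • ⟨x, d, τ⟩ : CayleyPoint S) (g • ⟨y, e, ρ⟩) ↔
      SameEdge (⟨x, d, τ⟩ : CayleyPoint S) ⟨y, e, ρ⟩ := by
    simp [SameEdge, smul_mk]
  by_cases h : SameEdge (⟨x, d, τ⟩ : CayleyPoint S) ⟨y, e, ρ⟩
  · exact (hedge.2 h).pathDist_eq.trans h.pathDist_eq.symm
  · simp only [pathDist, viaMin, hvia, if_neg h, if_neg (hedge.not.2 h)]

end CayleyPoint

variable [Group G]

/-- The Cayley graph of `G` with respect to `S`, with edges of length one. -/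
def CayleyGraph (hS : IsSymmGenSet S) : Type _ :=
  letI := CayleyPoint.pseudoMetricSpace hS
  SeparationQuotient (CayleyPoint S)

namespace CayleyGraph

open CayleyPoint

variable {hS : IsSymmGenSet S}

noncomputable instance : MetricSpace (CayleyGraph hS) :=
  letI := CayleyPoint.pseudoMetricSpace hS
  (inferInstance : MetricSpace (SeparationQuotient (CayleyPoint S)))

/-- The point of the Cayley graph on a given edge at a given position. -/
noncomputable def point (p : CayleyPoint S) : CayleyGraph hS :=
  letI := CayleyPoint.pseudoMetricSpace hS
  SeparationQuotient.mk p

theorem dist_point (p q : CayleyPoint S) :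
    dist (point p : CayleyGraph hS) (point q) = pathDist p q :=
  rfl

theorem exists_point (x : CayleyGraph hS) : ∃ p, point p = x :=
  letI := CayleyPoint.pseudoMetricSpace hS
  SeparationQuotient.surjective_mk x

noncomputable instance : MulAction G (CayleyGraph hS) :=
  letI := CayleyPoint.pseudoMetricSpace hS
  haveI : IsIsometricSMul G (CayleyPoint S) :=
    ⟨fun g => Isometry.of_dist_eq (pathDist_smul g)⟩
  (inferInstance : MulAction G (SeparationQuotient (CayleyPoint S)))

theorem smul_point (g : G) (p : CayleyPoint S) :
    g • (point p : CayleyGraph hS) = point (g • p) := rfl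

theorem isometricAction : IsometricAction G (CayleyGraph hS) := by
  intro g x y
  obtain ⟨p, rfl⟩ := exists_point x
  obtain ⟨q, rfl⟩ := exists_point y
  exact pathDist_smul g p q

/-- The vertex `g`, seen as the origin of the edge labelled `x₀`. -/
noncomputable def vertex (x₀ : S) (g : G) : CayleyGraph hS := point ⟨g, x₀, 0⟩

theorem smul_vertex (x₀ : S) (g h : G) :
    g • (vertex x₀ h : CayleyGraph hS) = vertex x₀ (g * h) := rfl

theorem dist_vertex_point_le (x₀ : S) (g : G) (p : CayleyPoint S) (i : Bool) :
    dist (vertex x₀ g : CayleyGraph hS) (point p) ≤ wordLength S (g⁻¹ * p.endpt i) + p.cost i := by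
  refine (pathDist_le_via hS _ _ false i).trans_eq ?_
  simp [via, cost, endpt]

theorem wordLength_le_dist (x₀ : S) (g : G) (p : CayleyPoint S) (i : Bool) :
    (wordLength S (g⁻¹ * p.endpt i) : ℝ) ≤
      dist (vertex x₀ g : CayleyGraph hS) (point p) + p.cost i := by
  rw [vertex, dist_point]
  rcases pathDist_cases ⟨g, x₀, 0⟩ p with h | ⟨j, k, h⟩
  · have := wordLength_endpt_le hS p false i
    have h1 : g = p.base := h.1
    rw [h.pathDist_eq, h1]
    simpa [endpt, cost, abs_of_nonneg p.pos.2.1] using this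
  · rw [h, via]
    have h0 : (⟨g, x₀, 0⟩ : CayleyPoint S).cost false = 0 := by simp [cost]
    have h1 := wordLength_endpt_le hS (⟨g, x₀, 0⟩ : CayleyPoint S) false j
    rw [h0, zero_add] at h1
    have h2 := wordLength_endpt_le hS p k i
    have h3 := hS.wordLength_mul_le (g⁻¹ * (⟨g, x₀, 0⟩ : CayleyPoint S).endpt j)
      ((((⟨g, x₀, 0⟩ : CayleyPoint S).endpt j)⁻¹ * p.endpt k) * ((p.endpt k)⁻¹ * p.endpt i))
    have h4 := hS.wordLength_mul_le (((⟨g, x₀, 0⟩ : CayleyPoint S).endpt j)⁻¹ * p.endpt k)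
      ((p.endpt k)⁻¹ * p.endpt i)
    have h5 := (Nat.cast_le (α := ℝ)).2 (h3.trans (Nat.add_le_add_left h4 _))
    push_cast at h5
    simp only [mul_assoc, mul_inv_cancel_left] at h5
    change (wordLength S (g⁻¹ * _) : ℝ) ≤ _ at h1
    linarith

theorem dist_vertex (x₀ : S) (g h : G) :
    dist (vertex x₀ g : CayleyGraph hS) (vertex x₀ h) = wordLength S (g⁻¹ * h) := by
  have h1 := dist_vertex_point_le (hS := hS) x₀ g ⟨h, x₀, 0⟩ false
  have h2 := wordLength_le_dist (hS := hS) x₀ g ⟨h, x₀, 0⟩ false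
  simp only [endpt, cost, Set.Icc.coe_zero, add_zero] at h1 h2
  exact h1.antisymm h2

theorem dist_point_vertex (x₀ : S) (p : CayleyPoint S) (i : Bool) :
    dist (point p : CayleyGraph hS) (vertex x₀ (p.endpt i)) ≤ p.cost i := by
  rw [dist_comm]
  simpa [wordLength_one] using dist_vertex_point_le (hS := hS) x₀ (p.endpt i) p i

theorem point_endpt (x₀ : S) (g : G) (x : S) (τ : unitInterval) (i : Bool)
    (hτ : (⟨g, x, τ⟩ : CayleyPoint S).cost i = 0) :
    (point ⟨g, x, τ⟩ : CayleyGraph hS) = vertex x₀ ((⟨g, x, τ⟩ : CayleyPoint S).endpt i) :=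
  dist_le_zero.1 ((dist_point_vertex x₀ _ i).trans_eq hτ)

/-- There is a geodesic from `x` to `y`. -/
def Joinable {X : Type*} [MetricSpace X] (x y : X) : Prop := ∃ γ : ℝ → X, GeodesicFromTo γ x y

theorem Joinable.symm {X : Type*} [MetricSpace X] {x y : X} (h : Joinable x y) :
    Joinable y x := by
  obtain ⟨γ, h0, h1, h2⟩ := h
  refine ⟨fun t => γ (dist x y - t), by simpa using h1, by simpa [dist_comm y x] using h0, ?_⟩
  intro s hs t ht
  rw [dist_comm y x] at hs ht
  dsimp only
  rw [h2 _ ⟨by linarith [hs.2], by linarith [hs.1]⟩ _ ⟨by linarith [ht.2], by linarith [ht.1]⟩,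
    abs_sub_comm]
  congr 1
  ring

theorem Joinable.trans {X : Type*} [MetricSpace X] {x y z : X} (hxy : Joinable x y)
    (hyz : Joinable y z) (h : dist x y + dist y z ≤ dist x z) : Joinable x z := by
  obtain ⟨γ, h0, h1, h2⟩ := hxy
  obtain ⟨η, k0, k1, k2⟩ := hyz
  have hd : dist x z = dist x y + dist y z := (dist_triangle x y z).antisymm h
  have n1 : (0 : ℝ) ≤ dist x y := dist_nonneg
  have n2 : (0 : ℝ) ≤ dist y z := dist_nonneg
  have hmix : ∀ s t, 0 ≤ s → s ≤ dist x y → dist x y ≤ t → t ≤ dist x z →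
      dist (γ s) (η (t - dist x y)) = |s - t| := fun s t hs hs' ht ht' => by
    have e1 := h2 0 ⟨le_rfl, n1⟩ s ⟨hs, hs'⟩
    have e2 := h2 s ⟨hs, hs'⟩ (dist x y) ⟨n1, le_rfl⟩
    have e3 := k2 0 ⟨le_rfl, n2⟩ (t - dist x y) ⟨by linarith, by linarith⟩
    have e4 := k2 (t - dist x y) ⟨by linarith, by linarith⟩ (dist y z) ⟨n2, le_rfl⟩
    rw [h0, abs_of_nonpos (by linarith)] at e1
    rw [h1, abs_of_nonpos (by linarith)] at e2
    rw [k0, abs_of_nonpos (by linarith)] at e3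
    rw [k1, abs_of_nonpos (by linarith)] at e4
    rw [abs_of_nonpos (by linarith)]
    have t1 := dist_triangle (γ s) y (η (t - dist x y))
    have t2 := dist_triangle x (γ s) z
    have t3 := dist_triangle (γ s) (η (t - dist x y)) z
    exact le_antisymm (by linarith) (by linarith)
  refine ⟨fun t => if t ≤ dist x y then γ t else η (t - dist x y), by simp [h0, n1], ?_, ?_⟩
  · rcases n2.eq_or_lt with hz | hz
    · have : y = z := dist_eq_zero.1 hz.symm
      subst this
      simp [h1]
    · simp [hd, k1, hz.not_ge]
  · intro s hs t ht
    dsimp only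
    split_ifs with c1 c2 c2
    · exact h2 s ⟨hs.1, c1⟩ t ⟨ht.1, c2⟩
    · exact hmix s t hs.1 c1 (not_le.1 c2).le ht.2
    · rw [dist_comm, abs_sub_comm]
      exact hmix t s ht.1 c2 (not_le.1 c1).le hs.2
    · rw [k2 _ ⟨by linarith, by linarith [hs.2]⟩ _ ⟨by linarith, by linarith [ht.2]⟩]
      congr 1
      ring

theorem dist_point_edge (g : G) (x : S) (τ ρ : unitInterval) :
    dist (point ⟨g, x, τ⟩ : CayleyGraph hS) (point ⟨g, x, ρ⟩) = |(τ : ℝ) - ρ| :=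
  SameEdge.pathDist_eq ⟨rfl, rfl⟩

theorem joinable_edge (g : G) (x : S) (τ ρ : unitInterval) :
    Joinable (point ⟨g, x, τ⟩ : CayleyGraph hS) (point ⟨g, x, ρ⟩) := by
  have key : ∀ τ ρ : unitInterval, τ ≤ ρ →
      Joinable (point ⟨g, x, τ⟩ : CayleyGraph hS) (point ⟨g, x, ρ⟩) := fun τ ρ h => by
    have h' : (τ : ℝ) ≤ ρ := h
    have hd : dist (point ⟨g, x, τ⟩ : CayleyGraph hS) (point ⟨g, x, ρ⟩) = ρ - τ := by
      rw [dist_point_edge, abs_sub_comm, abs_of_nonneg (sub_nonneg.2 h')]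
    refine ⟨fun u => point ⟨g, x, Set.projIcc 0 1 zero_le_one (τ + u)⟩, ?_, ?_, ?_⟩
    · simp
    · simp [hd]
    · intro s hs t ht
      rw [hd] at hs ht
      dsimp only
      have := τ.2.1
      have := ρ.2.2
      rw [dist_point_edge, Set.projIcc_of_mem _ ⟨by linarith [hs.1], by linarith [hs.2]⟩,
        Set.projIcc_of_mem _ ⟨by linarith [ht.1], by linarith [ht.2]⟩]
      congr 1
      ring
  rcases le_total τ ρ with h | h
  · exact key τ ρ h
  · exact (key ρ τ h).symm

theorem joinable_endpt (x₀ : S) (p : CayleyPoint S) (i : Bool) :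
    Joinable (point p : CayleyGraph hS) (vertex x₀ (p.endpt i)) := by
  cases i
  · have := point_endpt (hS := hS) x₀ p.base p.dir 0 false (by simp [cost])
    exact (congrArg (Joinable (point p)) this).mp (joinable_edge _ _ _ _)
  · have := point_endpt (hS := hS) x₀ p.base p.dir 1 true (by simp [cost])
    exact (congrArg (Joinable (point p)) this).mp (joinable_edge _ _ _ _)

theorem joinable_vertex (x₀ : S) (g h : G) :
    Joinable (vertex x₀ g : CayleyGraph hS) (vertex x₀ h) := by
  induction hn : wordLength S (g⁻¹ * h) generalizing g with
  | zero =>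
    rw [inv_mul_eq_one.1 (hS.eq_one_of_wordLength_eq_zero hn)]
    exact joinable_edge _ _ _ _
  | succ n ih =>
    obtain ⟨x, hx, k, hk, hkn⟩ := hS.exists_eq_mul hn
    have hk' : (g * x)⁻¹ * h = k := by rw [mul_inv_rev, mul_assoc, hk, inv_mul_cancel_left]
    have h1 : Joinable (vertex x₀ g : CayleyGraph hS) (vertex x₀ (g * x)) := by
      have := point_endpt (hS := hS) x₀ g ⟨x, hx⟩ 0 false (by simp [cost])
      have h' := joinable_endpt (hS := hS) x₀ ⟨g, ⟨x, hx⟩, 0⟩ true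
      rw [this] at h'
      exact h'
    refine h1.trans (ih (g * x) (by rw [hk', hkn])) ?_
    rw [dist_vertex, dist_vertex, dist_vertex, hn, hk', hkn, inv_mul_cancel_left,
      hS.wordLength_eq_one hx]
    push_cast
    linarith

theorem geodesicSpace : GeodesicSpace (CayleyGraph hS) := by
  intro x y
  obtain ⟨p, rfl⟩ := exists_point x
  obtain ⟨q, rfl⟩ := exists_point y
  change Joinable _ _
  rcases pathDist_cases p q with h | ⟨i, j, h⟩
  · obtain ⟨g, x, τ⟩ := p
    obtain ⟨g', x', τ'⟩ := q
    obtain ⟨rfl, rfl⟩ : g = g' ∧ x = x' := h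
    exact joinable_edge _ _ _ _
  · have h1 := dist_point_vertex (hS := hS) p.dir p i
    have h2 := dist_point_vertex (hS := hS) p.dir q j
    have h3 := dist_vertex (hS := hS) p.dir (p.endpt i) (q.endpt j)
    have h4 := dist_triangle (point p : CayleyGraph hS) (vertex p.dir (p.endpt i))
      (vertex p.dir (q.endpt j))
    have h5 := dist_triangle (point p : CayleyGraph hS) (vertex p.dir (q.endpt j)) (point q)
    have h6 : dist (point p : CayleyGraph hS) (point q) = _ := h
    rw [via] at h6
    rw [dist_comm] at h2
    exact ((joinable_endpt p.dir p i).trans (joinable_vertex _ _ _) (by linarith)).trans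
      (joinable_endpt p.dir q j).symm (by linarith)

theorem continuous_edge (g : G) (x : S) :
    Continuous fun τ : unitInterval => (point ⟨g, x, τ⟩ : CayleyGraph hS) :=
  (Isometry.of_dist_eq fun τ ρ => dist_point_edge g x τ ρ).continuous

/-- The union of the edges that start in `A`. -/
def edges (hS : IsSymmGenSet S) (A : Set G) : Set (CayleyGraph hS) :=
  ⋃ g ∈ A, ⋃ x : S, Set.range fun τ : unitInterval => (point ⟨g, x, τ⟩ : CayleyGraph hS)

theorem point_mem_edges {A : Set G} {p : CayleyPoint S} (hp : p.base ∈ A) :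
    (point p : CayleyGraph hS) ∈ edges hS A :=
  Set.mem_iUnion₂.2 ⟨p.base, hp, Set.mem_iUnion.2 ⟨p.dir, p.pos, rfl⟩⟩

theorem isCompact_edges {A : Set G} (hA : A.Finite) : IsCompact (edges hS A) := by
  have : Finite S := hS.finite
  exact hA.isCompact_biUnion fun g _ => isCompact_iUnion fun x =>
    isCompact_range (continuous_edge g x)

theorem wordLength_base_le (x₀ : S) (p : CayleyPoint S) {R : ℝ}
    (h : dist (point p : CayleyGraph hS) (vertex x₀ 1) ≤ R) :
    wordLength S p.base ≤ ⌊R + 1⌋₊ := by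
  refine Nat.le_floor ?_
  have h1 := wordLength_le_dist (hS := hS) x₀ 1 p false
  simp only [inv_one, one_mul, endpt, cost] at h1
  rw [dist_comm] at h
  linarith [p.pos.2.2]

theorem properSpace (x₀ : S) : ProperSpace (CayleyGraph hS) := by
  refine ProperSpace.of_seq_closedBall (β := ℕ) (l := atTop) (x := vertex x₀ 1)
    (r := fun n => (n : ℝ)) tendsto_natCast_atTop_atTop (Eventually.of_forall fun n => ?_)
  refine (isCompact_edges (hS.finite_ball ⌊(n : ℝ) + 1⌋₊)).of_isClosed_subset
    isClosed_closedBall fun y hy => ?_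
  obtain ⟨p, rfl⟩ := exists_point y
  exact point_mem_edges (wordLength_base_le x₀ p hy)

theorem properlyDiscontinuousAction (x₀ : S) :
    ProperlyDiscontinuousAction G (CayleyGraph hS) := by
  intro K hK
  obtain ⟨R, hR⟩ := hK.isBounded.subset_closedBall (vertex x₀ 1)
  refine (hS.finite_ball ⌊R + R⌋₊).subset ?_
  rintro g ⟨_, ⟨x, hx, rfl⟩, hgx⟩
  refine Nat.le_floor ?_
  have h1 : dist (g • x) (vertex x₀ 1) ≤ R := hR hgx
  have h2 : dist (g • x) (g • vertex x₀ 1) ≤ R :=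
    (isometricAction (hS := hS) g x _).trans_le (hR hx)
  have h3 := dist_triangle_left (vertex x₀ 1) (g • vertex x₀ 1) (g • x)
  rw [smul_vertex, dist_vertex, inv_one, one_mul, mul_one] at h3
  rw [smul_vertex, mul_one] at h2
  linarith

theorem exists_isCompact_iUnion_smul :
    ∃ K : Set (CayleyGraph hS), IsCompact K ∧ (⋃ g : G, (g • ·) '' K) = Set.univ := by
  refine ⟨edges hS {1}, isCompact_edges (Set.finite_singleton 1), Set.eq_univ_of_forall fun y => ?_⟩
  obtain ⟨⟨g, x, τ⟩, rfl⟩ := exists_point y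
  refine Set.mem_iUnion.2 ⟨g, point ⟨1, x, τ⟩, point_mem_edges rfl, ?_⟩
  change g • (point ⟨1, x, τ⟩ : CayleyGraph hS) = _
  rw [smul_point, CayleyPoint.smul_mk, mul_one]

theorem dist_vertex_smul (x₀ : S) (g : G) :
    dist (vertex x₀ 1 : CayleyGraph hS) (g • vertex x₀ 1) = wordLength S g := by
  rw [smul_vertex, dist_vertex, inv_one, one_mul, mul_one]

end CayleyGraph

end CayleyGraph

/-! ### A counting criterion for growth tightness -/

section Growth

variable {G : Type*} [Group G]

/-- A set `A` is graftable if, for a fixed connector `k`, the products `a * k * w` with `a ∈ A`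
act on a set `W` with bounded overlap. -/
def Graftable (S A : Set G) : Prop :=
  ∃ (W : Set G) (k : G) (C D : ℕ), 1 ∈ W ∧ ∀ a ∈ A, ∀ w ∈ W, a * k * w ∈ W ∧
    wordLength S (a * k * w) ≤ wordLength S a + C + wordLength S w ∧
    ∀ a' ∈ A, ∀ w' ∈ W, a * k * w = a' * k * w' → wordLength S (a⁻¹ * a') ≤ D

/-- Large weight in a graftable set forces exponential growth of the whole group. -/
theorem Graftable.exists_growth {S A : Set G} (hS : IsSymmGenSet S) (h : Graftable S A) :
    ∃ M C : ℕ, ∀ l : ℝ, 1 ≤ l → ∀ F : Finset G, (∀ a ∈ F, a ∈ A) →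
      M * l ^ C ≤ ∑ a ∈ F, l⁻¹ ^ wordLength S a →
      ∃ c > 0, ∀ N : ℕ, c * l ^ N ≤ Nat.card {g : G // wordLength S g ≤ N} := by
  classical
  obtain ⟨W, k, C, D, h1, hW⟩ := h
  refine ⟨(hS.finite_ball D).toFinset.card, C + 1, fun l hl F hF hsum => ?_⟩
  set M := (hS.finite_ball D).toFinset.card
  have hM : 0 < M := Finset.card_pos.2 ⟨1, by simp [wordLength_one]⟩
  have hl0 : 0 < l := by linarith
  set u : ℕ → Finset G := fun N => {g ∈ (hS.finite_ball N).toFinset | g ∈ W} with hu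
  have mem_u : ∀ N g, g ∈ u N ↔ wordLength S g ≤ N ∧ g ∈ W := fun N g => by simp [hu]
  obtain ⟨J, hJ⟩ : ∃ J, ∀ a ∈ F, wordLength S a + (C + 1) ≤ J :=
    ⟨F.sup fun a => wordLength S a + (C + 1),
      fun a ha => Finset.le_sup (f := fun a => wordLength S a + (C + 1)) ha⟩
  have key : ∀ N : ℕ, l ^ N ≤ l ^ J * (u N).card := by
    intro N
    induction N using Nat.strong_induction_on with
    | _ N ih =>
      rcases le_or_gt N J with hN | hN
      · have : 1 ≤ (u N).card := Finset.card_pos.2 ⟨1, (mem_u _ _).2 ⟨by simp [wordLength_one], h1⟩⟩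
        calc l ^ N ≤ l ^ J * 1 := by rw [mul_one]; exact pow_le_pow_right₀ hl hN
          _ ≤ l ^ J * (u N).card := by gcongr; exact mod_cast this
      · have hcard : ∑ a ∈ F, (u (N - (wordLength S a + (C + 1)))).card ≤ M * (u N).card := by
          rw [← Finset.card_sigma]
          have hmaps : ∀ x ∈ F.sigma fun a => u (N - (wordLength S a + (C + 1))),
              x.1 * k * x.2 ∈ u N := by
            rintro ⟨a, w⟩ hx
            simp only [Finset.mem_sigma, mem_u] at hx ⊢
            obtain ⟨ha, hw, hwW⟩ := hx
            obtain ⟨q1, q2, -⟩ := hW a (hF a ha) w hwW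
            have := hJ a ha
            exact ⟨by omega, q1⟩
          refine (Finset.card_le_mul_card_image_of_maps_to hmaps M fun z _ => ?_).trans_eq rfl
          rcases Finset.eq_empty_or_nonempty
            {x ∈ F.sigma fun a => u (N - (wordLength S a + (C + 1))) | x.1 * k * x.2 = z}
            with he | ⟨⟨a₀, w₀⟩, hx₀⟩
          · rw [he]; simp
          · simp only [Finset.mem_filter, Finset.mem_sigma, mem_u] at hx₀
            refine Finset.card_le_card_of_injOn (fun x => a₀⁻¹ * x.1) ?_ ?_
            · rintro ⟨a, w⟩ hx
              simp only [Finset.coe_filter, Finset.mem_sigma, mem_u, Set.mem_ofPred_eq] at hx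
              simp only [Set.Finite.coe_toFinset, Set.mem_ofPred_eq]
              exact (hW a₀ (hF _ hx₀.1.1) w₀ hx₀.1.2.2).2.2 a (hF _ hx.1.1) w hx.1.2.2
                (hx₀.2.trans hx.2.symm)
            · rintro ⟨a, w⟩ hx ⟨a', w'⟩ hx' haa
              simp only [Finset.coe_filter, Finset.mem_sigma, mem_u, Set.mem_ofPred_eq] at hx hx'
              obtain rfl : a = a' := mul_left_cancel haa
              obtain rfl : w = w' := mul_left_cancel (hx.2.trans hx'.2.symm)
              rfl
        have hsum' : ∑ a ∈ F, l ^ N * l⁻¹ ^ (C + 1) * l⁻¹ ^ wordLength S a ≤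
            l ^ J * ∑ a ∈ F, ((u (N - (wordLength S a + (C + 1)))).card : ℝ) := by
          rw [Finset.mul_sum]
          refine Finset.sum_le_sum fun a ha => ?_
          have hNa := hJ a ha
          refine le_trans (le_of_eq ?_) (ih (N - (wordLength S a + (C + 1))) (by omega))
          obtain ⟨m, rfl⟩ := Nat.exists_eq_add_of_le (hNa.trans hN.le)
          rw [Nat.add_sub_cancel_left, pow_add, pow_add l (wordLength S a), inv_pow, inv_pow]
          field_simp
        rw [← Finset.mul_sum] at hsum'
        have hM' : (0 : ℝ) < M := mod_cast hM
        have e1 : l ^ N * M ≤ l ^ N * l⁻¹ ^ (C + 1) * ∑ a ∈ F, l⁻¹ ^ wordLength S a := by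
          calc l ^ N * M = l ^ N * l⁻¹ ^ (C + 1) * (M * l ^ (C + 1)) := by
                rw [inv_pow]; field_simp
            _ ≤ _ := by gcongr
        have e2 : (∑ a ∈ F, ((u (N - (wordLength S a + (C + 1)))).card : ℝ)) ≤ M * (u N).card :=
          mod_cast hcard
        have e3 := e1.trans (hsum'.trans (mul_le_mul_of_nonneg_left e2 (by positivity)))
        nlinarith
  refine ⟨(l ^ J)⁻¹, by positivity, fun N => ?_⟩
  rw [inv_mul_le_iff₀ (by positivity)]
  refine (key N).trans ?_
  have : (u N).card ≤ Nat.card {g : G // wordLength S g ≤ N} := by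
    refine le_trans ?_ (Nat.card_eq_card_finite_toFinset (hS.finite_ball N)).ge
    exact Finset.card_le_card (Finset.filter_subset _ _)
  gcongr

/-- If balls grow exponentially at rate `l`, the weights `l⁻¹ ^ m` are not summable. -/
theorem not_summable_of_pow_le {T : Type*} {m : T → ℕ} (hm : ∀ n, {q | m q ≤ n}.Finite) {l : ℝ}
    (hl : 1 < l) (h : ∀ n : ℕ, l ^ n ≤ Nat.card {q // m q ≤ n}) :
    ¬ Summable fun q => l⁻¹ ^ m q := by
  classical
  intro hs
  have hl0 : 0 < l := by linarith
  obtain ⟨s, hs⟩ := summable_iff_vanishing_norm.1 hs (1 / 2) (by norm_num)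
  have key : ∀ n : ℕ, l ^ n ≤ 2 * s.card := fun n => by
    set t := (hm n).toFinset
    have ht : l⁻¹ ^ n * (t \ s).card ≤ 1 / 2 := by
      refine le_trans ?_ (hs (t \ s) Finset.sdiff_disjoint).le
      rw [Real.norm_of_nonneg (Finset.sum_nonneg fun _ _ => by positivity), mul_comm,
        ← nsmul_eq_mul]
      refine Finset.card_nsmul_le_sum _ _ _ fun q hq => ?_
      have : m q ≤ n := by simpa [t] using (Finset.mem_sdiff.1 hq).1
      exact pow_le_pow_of_le_one (by positivity) (inv_le_one_of_one_le₀ hl.le) this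
    have h1 : (Nat.card {q // m q ≤ n} : ℝ) ≤ s.card + (t \ s).card := by
      have e1 : Nat.card {q // m q ≤ n} = t.card := Nat.card_eq_card_finite_toFinset (hm n)
      rw [e1]
      have : t.card ≤ s.card + (t \ s).card := by
        rw [← Finset.card_sdiff_add_card_inter t s, add_comm]
        gcongr
        exact Finset.inter_subset_right
      exact mod_cast this
    have h2 := (h n).trans h1
    rw [inv_pow, inv_mul_le_iff₀ (by positivity)] at ht
    linarith
  obtain ⟨n, hn⟩ := pow_unbounded_of_one_lt (2 * (s.card : ℝ)) hl
  exact (key n).not_gt hn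

/-- If finitely many classes cover a family of nonnegative terms that is not summable, some class
has large finite sums. -/
theorem exists_class_sum_ge {T ι : Type*} [Finite ι] {f : T → ℝ} (hf : ∀ q, 0 ≤ f q)
    (h : ¬ Summable f) (cls : T → ι) :
    ∃ i, ∀ B : ℝ, ∃ F : Finset T, (∀ q ∈ F, cls q = i) ∧ B < ∑ q ∈ F, f q := by
  classical
  have := Fintype.ofFinite ι
  by_contra! hcon
  choose B hB using hcon
  refine h ?_
  have hsum : ∀ i, Summable fun q => if cls q = i then f q else 0 := fun i => by
    refine summable_of_sum_le (c := B i) (fun q => ?_) fun u => ?_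
    · dsimp only
      split_ifs
      · exact hf q
      · exact le_rfl
    · rw [← Finset.sum_filter]
      exact hB i _ fun q hq => (Finset.mem_filter.1 hq).2
  have := summable_sum (s := Finset.univ) fun i _ => hsum i
  refine this.congr fun q => ?_
  simp

section Quotient

variable (S : Set G) (Γ : Subgroup G)

/-- The length of a shortest representative of a coset. -/
noncomputable def cosetLength (q : G ⧸ Γ) : ℕ :=
  sInf {n | ∃ g : G, QuotientGroup.mk g = q ∧ wordLength S g = n}

theorem exists_wordLength_eq_cosetLength (q : G ⧸ Γ) :
    ∃ g : G, QuotientGroup.mk g = q ∧ wordLength S g = cosetLength S Γ q := by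
  obtain ⟨g, hg⟩ := QuotientGroup.mk_surjective q
  exact Nat.sInf_mem (s := {n | ∃ g : G, QuotientGroup.mk g = q ∧ wordLength S g = n})
    ⟨_, g, hg, rfl⟩

theorem cosetLength_le (g : G) : cosetLength S Γ (QuotientGroup.mk g) ≤ wordLength S g :=
  Nat.sInf_le ⟨g, rfl, rfl⟩

theorem cosetLength_le_iff (q : G ⧸ Γ) (n : ℕ) :
    cosetLength S Γ q ≤ n ↔ ∃ g : G, QuotientGroup.mk g = q ∧ wordLength S g ≤ n := by
  constructor
  · intro h
    obtain ⟨g, hg, hg'⟩ := exists_wordLength_eq_cosetLength S Γ q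
    exact ⟨g, hg, hg'.trans_le h⟩
  · rintro ⟨g, rfl, hg⟩
    exact (cosetLength_le S Γ g).trans hg

variable {S}

theorem finite_cosetLength_le (hS : IsSymmGenSet S) (n : ℕ) :
    {q : G ⧸ Γ | cosetLength S Γ q ≤ n}.Finite := by
  refine ((hS.finite_ball n).image QuotientGroup.mk).subset fun q hq => ?_
  obtain ⟨g, hg, hg'⟩ := (cosetLength_le_iff S Γ q n).1 hq
  exact ⟨g, hg', hg⟩

theorem card_cosetLength_le_add [Γ.Normal] (hS : IsSymmGenSet S) (m n : ℕ) :
    Nat.card {q : G ⧸ Γ // cosetLength S Γ q ≤ m + n} ≤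
      Nat.card {q : G ⧸ Γ // cosetLength S Γ q ≤ m} *
        Nat.card {q : G ⧸ Γ // cosetLength S Γ q ≤ n} := by
  have : Finite {q : G ⧸ Γ // cosetLength S Γ q ≤ m} :=
    (finite_cosetLength_le Γ hS m).to_subtype
  have : Finite {q : G ⧸ Γ // cosetLength S Γ q ≤ n} :=
    (finite_cosetLength_le Γ hS n).to_subtype
  have key : ∀ q : {q : G ⧸ Γ // cosetLength S Γ q ≤ m + n},
      ∃ x : {q : G ⧸ Γ // cosetLength S Γ q ≤ m} × {q : G ⧸ Γ // cosetLength S Γ q ≤ n},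
        (x.1 : G ⧸ Γ) * x.2 = q := by
    rintro ⟨q, hq⟩
    obtain ⟨g, rfl, hg⟩ := (cosetLength_le_iff S Γ q _).1 hq
    obtain ⟨g₁, g₂, rfl, h₁, h₂⟩ := hS.exists_mul_of_le_add hg
    exact ⟨⟨⟨g₁, (cosetLength_le S Γ g₁).trans h₁⟩, ⟨g₂, (cosetLength_le S Γ g₂).trans h₂⟩⟩, rfl⟩
  choose f hf using key
  rw [← Nat.card_prod]
  refine Nat.card_le_card_of_injective f fun q q' h => Subtype.ext ?_
  rw [← hf q, ← hf q', h]

theorem card_cosetLength_le_pos (hS : IsSymmGenSet S) (n : ℕ) :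
    0 < Nat.card {q : G ⧸ Γ // cosetLength S Γ q ≤ n} := by
  have : Finite {q : G ⧸ Γ // cosetLength S Γ q ≤ n} :=
    (finite_cosetLength_le Γ hS n).to_subtype
  have : Nonempty {q : G ⧸ Γ // cosetLength S Γ q ≤ n} :=
    ⟨⟨QuotientGroup.mk 1, (cosetLength_le S Γ 1).trans (by simp [wordLength_one])⟩⟩
  exact Nat.card_pos

end Quotient

/-- Passing from integral to real radii. -/
theorem tendsto_log_card_floor_div {u : ℕ → ℝ} {δ : ℝ}
    (h : Tendsto (fun n : ℕ => u n / n) atTop (nhds δ)) :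
    Tendsto (fun r : ℝ => u ⌊r⌋₊ / r) atTop (nhds δ) := by
  have h1 := h.comp (tendsto_nat_floor_atTop (α := ℝ))
  have h2 := h1.mul (tendsto_nat_floor_div_atTop (R := ℝ))
  rw [mul_one] at h2
  refine h2.congr' ?_
  filter_upwards [eventually_ge_atTop 1] with r hr
  have : (0 : ℝ) < ⌊r⌋₊ := mod_cast Nat.floor_pos.2 hr
  simp only [Function.comp]
  field_simp

variable {X : Type*} [MetricSpace X] [MulAction G X] {S : Set G} {o : X}

theorem ofReal_log_le_growthExp (ho : ∀ g : G, dist o (g • o) = wordLength S g)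
    {l c : ℝ} (hl : 1 < l) (hc : 0 < c)
    (h : ∀ N : ℕ, c * l ^ N ≤ Nat.card {g : G // wordLength S g ≤ N}) :
    ENNReal.ofReal (Real.log l) ≤ growthExp o (Set.univ : Set G) := by
  have h1 : Tendsto (fun n : ℕ => (Real.log c + n * Real.log l) / n) atTop
      (nhds (0 + Real.log l)) := by
    have h0 : Tendsto (fun n : ℕ => Real.log c / (n : ℝ)) atTop (nhds 0) :=
      tendsto_const_div_atTop_nhds_zero_nat _
    refine (h0.add_const (Real.log l)).congr' ?_
    filter_upwards [eventually_ge_atTop 1] with n hn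
    have : (0 : ℝ) < n := mod_cast hn
    field_simp
  rw [zero_add] at h1
  have h2 := ENNReal.tendsto_ofReal
    (tendsto_log_card_floor_div (u := fun n => Real.log c + n * Real.log l) h1)
  rw [← h2.limsup_eq]
  refine Filter.limsup_le_limsup ?_
  filter_upwards [eventually_ge_atTop 1] with r hr
  refine ENNReal.ofReal_le_ofReal ?_
  have hset : Nat.card {g : G // g ∈ (Set.univ : Set G) ∧ dist o (g • o) ≤ r} =
      Nat.card {g : G // wordLength S g ≤ ⌊r⌋₊} := by
    refine Nat.card_congr (Equiv.subtypeEquivRight fun g => ?_)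
    rw [ho, Nat.le_floor_iff (by linarith)]
    simp
  rw [hset]
  gcongr
  rw [← Real.log_pow, ← Real.log_mul hc.ne' (by positivity)]
  exact Real.log_le_log (by positivity) (h _)

theorem iInf_dist_le_iff (Γ : Subgroup G) (ho : ∀ g : G, dist o (g • o) = wordLength S g) (g : G)
    {r : ℝ} (hr : 0 ≤ r) :
    (⨅ γ : Γ, dist o ((g * γ) • o)) ≤ r ↔ ∃ γ ∈ Γ, wordLength S (g * γ) ≤ ⌊r⌋₊ := by
  simp only [ho]
  constructor
  · intro h
    obtain ⟨γ, hγ⟩ : ∃ γ : Γ, ∀ γ' : Γ, wordLength S (g * γ) ≤ wordLength S (g * γ') := by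
      obtain ⟨γ, hγ⟩ := Nat.sInf_mem (Set.range_nonempty fun γ : Γ => wordLength S (g * γ))
      exact ⟨γ, fun γ' => hγ.trans_le (Nat.sInf_le ⟨γ', rfl⟩)⟩
    refine ⟨γ, γ.2, Nat.le_floor (le_trans ?_ h)⟩
    exact le_ciInf fun γ' => mod_cast hγ γ'
  · rintro ⟨γ, hγ, h⟩
    refine (ciInf_le ⟨0, ?_⟩ (⟨γ, hγ⟩ : Γ)).trans ((Nat.le_floor_iff hr).1 h)
    rintro _ ⟨γ', rfl⟩
    positivity

theorem quotGrowthExp_eq (Γ : Subgroup G)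
    (ho : ∀ g : G, dist o (g • o) = wordLength S g) {δ : ℝ}
    (h : Tendsto (fun n : ℕ => Real.log (Nat.card {q : G ⧸ Γ // cosetLength S Γ q ≤ n}) / n)
      atTop (nhds δ)) : quotGrowthExp o Γ = ENNReal.ofReal δ := by
  refine ((ENNReal.tendsto_ofReal (tendsto_log_card_floor_div
    (u := fun n => Real.log (Nat.card {q : G ⧸ Γ // cosetLength S Γ q ≤ n})) h)).congr'
      ?_).limsup_eq
  filter_upwards [eventually_ge_atTop 0] with r hr
  have hset : Nat.card {q : G ⧸ Γ // cosetLength S Γ q ≤ ⌊r⌋₊} =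
      Nat.card {q : G ⧸ Γ // ∃ g : G, QuotientGroup.mk g = q ∧
        (⨅ γ : Γ, dist o ((g * γ) • o)) ≤ r} := by
    refine Nat.card_congr (Equiv.subtypeEquivRight fun q => ?_)
    simp only [cosetLength_le_iff, iInf_dist_le_iff Γ ho _ hr]
    constructor
    · rintro ⟨g, hg, h⟩
      exact ⟨g, hg, 1, Γ.one_mem, by rwa [mul_one]⟩
    · rintro ⟨g, hg, γ, hγ, h⟩
      exact ⟨g * γ, by rw [← hg]; exact QuotientGroup.mk_mul_of_mem g hγ, h⟩
  rw [hset]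

/-- A criterion for growth tightness: minimal representatives of cosets split into finitely many
graftable classes. -/
theorem growthTight_of_graftable (hS : IsSymmGenSet S)
    (ho : ∀ g : G, dist o (g • o) = wordLength S g)
    (hexp : ∀ N : ℕ, (2 : ℝ) ^ N ≤ Nat.card {g : G // wordLength S g ≤ N})
    {ι : Type*} [Finite ι] (cls : G → ι)
    (h : ∀ Γ : Subgroup G, Γ.Normal → (Γ : Set G).Infinite → ∀ i,
      Graftable S {a | cls a = i ∧ ∀ γ ∈ Γ, wordLength S a ≤ wordLength S (a * γ)}) :
    GrowthTight G o := by
  intro Γ hΓ hinf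
  set Q : ℕ → ℝ := fun n => Nat.card {q : G ⧸ Γ // cosetLength S Γ q ≤ n} with hQ
  have hQ1 : ∀ n, 1 ≤ Q n := fun n =>
    Nat.one_le_cast.2 (card_cosetLength_le_pos Γ hS n)
  have hsub : Subadditive fun n => Real.log (Q n) := fun m n => by
    rw [← Real.log_mul (by linarith [hQ1 m]) (by linarith [hQ1 n])]
    refine Real.log_le_log (by linarith [hQ1 (m + n)]) ?_
    simp only [hQ, ← Nat.cast_mul]
    exact Nat.cast_le.2 (card_cosetLength_le_add Γ hS m n)
  have hbdd : BddBelow (Set.range fun n => Real.log (Q n) / n) := by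
    refine ⟨0, ?_⟩
    rintro _ ⟨n, rfl⟩
    exact div_nonneg (Real.log_nonneg (hQ1 n)) (Nat.cast_nonneg n)
  have hlim := hsub.tendsto_lim hbdd
  rw [quotGrowthExp_eq Γ ho hlim]
  set δ := hsub.lim
  suffices ∃ l c : ℝ, δ < Real.log l ∧ 1 < l ∧ 0 < c ∧
      ∀ N : ℕ, c * l ^ N ≤ Nat.card {g : G // wordLength S g ≤ N} by
    obtain ⟨l, c, h1, h2, h3, h4⟩ := this
    refine lt_of_lt_of_le ?_ (ofReal_log_le_growthExp ho h2 h3 h4)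
    exact (ENNReal.ofReal_lt_ofReal_iff (Real.log_pos h2)).2 h1
  rcases le_or_gt δ 0 with hδ | hδ
  · exact ⟨2, 1, hδ.trans_lt (Real.log_pos one_lt_two), one_lt_two, one_pos,
      fun N => by simpa using hexp N⟩
  have hl0 : 1 < Real.exp δ := Real.one_lt_exp_iff.2 hδ
  have hpow : ∀ n : ℕ, Real.exp δ ^ n ≤ Q n := fun n => by
    rcases Nat.eq_zero_or_pos n with rfl | hn
    · simpa using hQ1 0
    have h1 := hsub.lim_le_div hbdd hn.ne'
    rw [le_div_iff₀ (by exact_mod_cast hn)] at h1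
    rw [← Real.exp_nat_mul, mul_comm, ← Real.le_log_iff_exp_le (by linarith [hQ1 n])]
    exact h1
  choose rep hrep hrep' using exists_wordLength_eq_cosetLength S Γ
  obtain ⟨i, hi⟩ := exists_class_sum_ge (fun q => by positivity)
    (not_summable_of_pow_le (finite_cosetLength_le Γ hS) hl0 hpow) fun q => cls (rep q)
  obtain ⟨M, C, hMC⟩ := (h Γ hΓ hinf i).exists_growth hS
  obtain ⟨F, hF, hsum⟩ := hi (M * Real.exp δ ^ C)
  classical
  have hev : ∀ᶠ l : ℝ in nhds (Real.exp δ),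
      M * l ^ C < ∑ q ∈ F, l⁻¹ ^ cosetLength S Γ q := by
    refine ContinuousAt.eventually_lt (by fun_prop) ?_ hsum
    have : ContinuousAt (fun l : ℝ => l⁻¹) (Real.exp δ) := continuousAt_inv₀ (by positivity)
    exact tendsto_finsetSum _ fun q _ => this.pow _
  obtain ⟨l, hl, hlδ⟩ := ((hev.filter_mono nhdsWithin_le_nhds).and
    (self_mem_nhdsWithin (a := Real.exp δ) (s := Set.Ioi (Real.exp δ)))).exists
  have hlδ : Real.exp δ < l := hlδ
  have hinj : Function.Injective rep := fun q q' hq => by rw [← hrep q, ← hrep q', hq]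
  obtain ⟨c, hc, hgrow⟩ := hMC l (hl0.trans hlδ).le (F.image rep) (fun a ha => by
    obtain ⟨q, hq, rfl⟩ := Finset.mem_image.1 ha
    refine ⟨hF q hq, fun γ hγ => ?_⟩
    rw [hrep' q, cosetLength_le_iff]
    exact ⟨rep q * γ, by rw [QuotientGroup.mk_mul_of_mem _ hγ, hrep], le_rfl⟩) (by
    rw [Finset.sum_image fun _ _ _ _ h => hinj h]
    simp only [hrep']
    exact hl.le)
  exact ⟨l, c, (Real.lt_log_iff_exp_lt (by linarith)).2 hlδ, hl0.trans hlδ, hc, hgrow⟩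

end Growth

/-! ### Groups with the tree-like structure of the snowflake groups -/

section Snowflake

variable {G : Type*} [Group G]

/-- The exponent of `b` in the conjugate of `a` by a stable letter. -/
def edgeSign : Bool → ℤ
  | false => 1
  | true => -1

/-- The structure of the snowflake group as a multiple HNN extension of `⟨a, b⟩ ≅ ℤ²` with stable
letters `e false` and `e true`. The function `χ σ` counts the signed crossings of the base edge
labelled `σ` of the Bass–Serre tree along paths from the base vertex. -/
structure IsSnowflake (r : ℕ) (a b : G) (e : Bool → G) (χ : Bool → G → ℤ) : Prop where
  comm : Commute a b
  conj : ∀ σ, (e σ)⁻¹ * a * e σ = a ^ (r : ℤ) * b ^ edgeSign σ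
  inj : ∀ m n : ℤ, a ^ m * b ^ n = 1 → m = 0 ∧ n = 0
  gen : Subgroup.closure {x | x = a ∨ ∃ σ, x = e σ} = ⊤
  cross_one : ∀ σ, χ σ 1 = 0
  cross_mul_a : ∀ σ g, χ σ (g * a) = χ σ g
  cross_mul_b : ∀ σ g, χ σ (g * b) = χ σ g
  cross_mul_of_ne : ∀ σ τ g, τ ≠ σ → χ σ (g * e τ) = χ σ g
  cross_mul_of_notMem : ∀ σ g, g ∉ Subgroup.zpowers a → χ σ (g * e σ) = χ σ g
  cross_stable : ∀ σ, χ σ (e σ) = 1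
  cross_mem : ∀ σ, ∀ g ∈ Subgroup.zpowers a, χ σ (g * e σ) = χ σ g + 1

/-- The generators `a` and the stable letters, with their inverses. -/
def stableGens (a : G) (e : Bool → G) : Set G :=
  {x | x = a ∨ x = a⁻¹ ∨ ∃ σ, x = e σ ∨ x = (e σ)⁻¹}

namespace IsSnowflake

variable {r : ℕ} {a b : G} {e : Bool → G} {χ : Bool → G → ℤ}

theorem cross_mul_zpow_a (H : IsSnowflake r a b e χ)
    (σ : Bool) (g : G) (m : ℤ) : χ σ (g * a ^ m) = χ σ g := by
  induction m using Int.induction_on with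
  | zero => simp
  | succ n ih => rw [zpow_add_one, ← mul_assoc, H.cross_mul_a, ih]
  | pred n ih => rw [← ih, ← H.cross_mul_a, mul_assoc, ← zpow_add_one, sub_add_cancel]

theorem cross_mul_zpow_b (H : IsSnowflake r a b e χ)
    (σ : Bool) (g : G) (m : ℤ) : χ σ (g * b ^ m) = χ σ g := by
  induction m using Int.induction_on with
  | zero => simp
  | succ n ih => rw [zpow_add_one, ← mul_assoc, H.cross_mul_b, ih]
  | pred n ih => rw [← ih, ← H.cross_mul_b, mul_assoc, ← zpow_add_one, sub_add_cancel]

theorem cross_zpow_a (H : IsSnowflake r a b e χ) (σ : Bool) (m : ℤ) : χ σ (a ^ m) = 0 := by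
  rw [← one_mul (a ^ m), H.cross_mul_zpow_a, H.cross_one]

theorem cross_zpow_b (H : IsSnowflake r a b e χ) (σ : Bool) (m : ℤ) : χ σ (b ^ m) = 0 := by
  rw [← one_mul (b ^ m), H.cross_mul_zpow_b, H.cross_one]

theorem cross_mul_inv_of_ne (H : IsSnowflake r a b e χ)
    {σ τ : Bool} (h : τ ≠ σ) (g : G) : χ σ (g * (e τ)⁻¹) = χ σ g := by
  rw [← H.cross_mul_of_ne σ τ _ h, inv_mul_cancel_right]

/-- `χ σ` increases only along the base edge labelled `σ`. -/
theorem eq_of_cross_lt (H : IsSnowflake r a b e χ) {σ : Bool} {g x : G} (hx : x ∈ stableGens a e)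
    (h : χ σ g < χ σ (g * x)) : x = e σ ∧ g ∈ Subgroup.zpowers a := by
  rcases hx with rfl | rfl | ⟨τ, rfl | rfl⟩
  · rw [H.cross_mul_a] at h
    exact absurd h (lt_irrefl _)
  · rw [← H.cross_mul_a σ (g * a⁻¹), inv_mul_cancel_right] at h
    exact absurd h (lt_irrefl _)
  · by_cases hτ : τ = σ
    · subst hτ
      refine ⟨rfl, ?_⟩
      by_contra hg
      rw [H.cross_mul_of_notMem τ g hg] at h
      exact lt_irrefl _ h
    · rw [H.cross_mul_of_ne σ τ g hτ] at h
      exact absurd h (lt_irrefl _)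
  · by_cases hτ : τ = σ
    · subst hτ
      by_cases hg : g * (e τ)⁻¹ ∈ Subgroup.zpowers a
      · have := H.cross_mem τ _ hg
        rw [inv_mul_cancel_right] at this
        omega
      · have := H.cross_mul_of_notMem τ _ hg
        rw [inv_mul_cancel_right] at this
        omega
    · rw [H.cross_mul_inv_of_ne hτ] at h
      exact absurd h (lt_irrefl _)

theorem inv_mem_stableGens (H : IsSnowflake r a b e χ)
    {x : G} (hx : x ∈ stableGens a e) : x⁻¹ ∈ stableGens a e := by
  rcases hx with rfl | rfl | ⟨τ, rfl | rfl⟩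
  · exact Or.inr (Or.inl rfl)
  · exact Or.inl (inv_inv _)
  · exact Or.inr (Or.inr ⟨τ, Or.inr rfl⟩)
  · exact Or.inr (Or.inr ⟨τ, Or.inl (inv_inv _)⟩)

/-- `χ σ` decreases only along the inverse of the base edge labelled `σ`. -/
theorem eq_of_lt_cross (H : IsSnowflake r a b e χ) {σ : Bool} {g x : G} (hx : x ∈ stableGens a e)
    (h : χ σ (g * x) < χ σ g) : x = (e σ)⁻¹ ∧ g * x ∈ Subgroup.zpowers a := by
  have := H.eq_of_cross_lt (g := g * x) (H.inv_mem_stableGens hx)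
    (by rwa [mul_inv_cancel_right])
  exact ⟨by rw [← this.1, inv_inv], this.2⟩

theorem isSymmGenSet (H : IsSnowflake r a b e χ) : IsSymmGenSet (stableGens a e) where
  finite := by
    refine ((Set.finite_range e).union ((Set.finite_range fun σ => (e σ)⁻¹).union
      (Set.toFinite {a, a⁻¹}))).subset ?_
    rintro x (h | h | ⟨τ, h | h⟩)
    · exact Or.inr (Or.inr (Or.inl h))
    · exact Or.inr (Or.inr (Or.inr h))
    · exact Or.inl ⟨τ, h.symm⟩
    · exact Or.inr (Or.inl ⟨τ, h.symm⟩)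
  inv_mem x hx := H.inv_mem_stableGens hx
  one_notMem := by
    have ha : a ≠ 1 := fun h => by simpa [h] using H.inj 1 0
    have he : ∀ σ, e σ ≠ 1 := fun σ h => by
      have := H.cross_stable σ
      rw [h, H.cross_one] at this
      exact zero_ne_one this
    rintro (h | h | ⟨τ, h | h⟩)
    · exact ha h.symm
    · exact ha (inv_eq_one.1 h.symm)
    · exact he τ h.symm
    · exact he τ (inv_eq_one.1 h.symm)
  exists_word g := by
    have hg : g ∈ (Subgroup.closure {x | x = a ∨ ∃ σ, x = e σ}).toSubmonoid := by
      rw [H.gen]; trivial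
    rw [Subgroup.closure_toSubmonoid] at hg
    obtain ⟨l, hl, rfl⟩ := Submonoid.exists_list_of_mem_closure hg
    refine ⟨l, fun x hx => ?_, rfl⟩
    rcases hl x hx with (h | ⟨σ, h⟩) | (h | ⟨σ, h⟩)
    · exact Or.inl h
    · exact Or.inr (Or.inr ⟨σ, Or.inl h⟩)
    · exact Or.inr (Or.inl (by rw [← h, inv_inv]))
    · exact Or.inr (Or.inr ⟨σ, Or.inr (by rw [← h, inv_inv])⟩)

theorem induction_right (H : IsSnowflake r a b e χ) {P : G → Prop} (one : P 1)
    (mul : ∀ g, ∀ x ∈ stableGens a e, P g → P (g * x)) (g : G) : P g := by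
  obtain ⟨l, hl, rfl⟩ := H.isSymmGenSet.exists_word g
  induction l using List.reverseRecOn with
  | nil => simpa using one
  | append_singleton l x ih =>
    rw [List.prod_append, List.prod_singleton]
    exact mul _ _ (hl x (by simp)) (ih fun y hy => hl y (by simp [hy]))

/-- Translating a half-tree that avoids the base edges does not change the crossing numbers. -/
theorem cross_mul_eq (H : IsSnowflake r a b e χ)
    {σ₁ σ₂ : Bool} {x : G} (hx : σ₁ ≠ σ₂ ∨ x ∉ Subgroup.zpowers a)
    {V : ℤ → Prop} (hV : ¬ V (χ σ₁ x⁻¹)) (h : G) : V (χ σ₁ h) → χ σ₂ (x * h) = χ σ₂ x := by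
  have hmem : ∀ g, x * g ∈ Subgroup.zpowers a → ¬ V (χ σ₁ g) := by
    rintro g ⟨m, hm⟩
    rwa [← inv_mul_cancel_left x g, ← hm, H.cross_mul_zpow_a]
  have hbase : ∀ g ∈ Subgroup.zpowers a, χ σ₂ (x * g) = χ σ₂ x := by
    rintro _ ⟨m, rfl⟩
    exact H.cross_mul_zpow_a _ _ _
  have hedge : ∀ g ∈ Subgroup.zpowers a, χ σ₂ (x * (g * e σ₁)) = χ σ₂ x := by
    intro g hg
    rw [← mul_assoc]
    by_cases hσ : σ₁ = σ₂
    · subst hσ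
      rw [H.cross_mul_of_notMem, hbase g hg]
      rw [Subgroup.mul_mem_cancel_right _ hg]
      exact hx.resolve_left (by simp)
    · rw [H.cross_mul_of_ne _ _ _ hσ, hbase g hg]
  refine H.induction_right (P := fun h => V (χ σ₁ h) → χ σ₂ (x * h) = χ σ₂ x) (by simp) ?_ h
  intro g y hy ih hVg
  rcases lt_trichotomy (χ σ₁ g) (χ σ₁ (g * y)) with hlt | heq | hlt
  · obtain ⟨rfl, hg⟩ := H.eq_of_cross_lt hy hlt
    exact hedge g hg
  · rw [← ih (by rwa [heq])]
    rcases lt_trichotomy (χ σ₂ (x * g)) (χ σ₂ (x * g * y)) with h1 | h1 | h1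
    · exact absurd (heq ▸ hVg) (hmem g (H.eq_of_cross_lt hy h1).2)
    · rw [h1, mul_assoc]
    · have := (H.eq_of_lt_cross hy h1).2
      rw [mul_assoc] at this
      exact absurd hVg (hmem _ this)
  · exact hbase _ (H.eq_of_lt_cross hy hlt).2

theorem zpow_b_notMem (H : IsSnowflake r a b e χ)
    {n : ℤ} (hn : n ≠ 0) : b ^ n ∉ Subgroup.zpowers a := by
  rintro ⟨m, hm⟩
  have hm : a ^ m = b ^ n := hm
  refine hn (neg_eq_zero.1 (H.inj m (-n) ?_).2)
  rw [hm, ← zpow_add, add_neg_cancel, zpow_zero]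

/-- One of `h` and `b⁻¹ * h` is not beyond the base edge labelled `σ`. -/
theorem cross_inv_b_mul (H : IsSnowflake r a b e χ)
    (σ : Bool) {h : G} (hh : χ σ h ≠ 0) : χ σ (b⁻¹ * h) = 0 := by
  have hb := H.zpow_b_notMem (n := -1) (by norm_num)
  rw [zpow_neg_one] at hb
  rw [H.cross_mul_eq (σ₁ := σ) (Or.inr hb) (V := fun n => n ≠ 0) _ h hh]
  · simpa using H.cross_zpow_b σ (-1)
  · simpa using H.cross_zpow_b σ 1

theorem cross_turn (H : IsSnowflake r a b e χ) {σ τ : Bool} (hστ : σ ≠ τ) {v : G} (hv : χ τ v = 0) :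
    χ σ (e σ * (e τ)⁻¹ * v) = 1 := by
  rw [H.cross_mul_eq (σ₁ := τ) (Or.inl hστ.symm) (V := fun n => n = 0) _ v hv,
    H.cross_mul_inv_of_ne hστ.symm, H.cross_stable]
  rw [mul_inv_rev, inv_inv, H.cross_mul_inv_of_ne hστ, H.cross_stable]
  exact one_ne_zero

theorem cross_mul_turn (H : IsSnowflake r a b e χ)
    {σ τ : Bool} (hστ : σ ≠ τ) {y v : G} (hy : χ σ y⁻¹ = 0)
    (hy' : χ τ y = 0) (hv : χ τ v = 0) : χ τ (y * (e σ * (e τ)⁻¹ * v)) = 0 := by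
  rw [H.cross_mul_eq (σ₁ := σ) (Or.inl hστ) (V := fun n => n ≠ 0) (by simpa using hy), hy']
  rw [H.cross_turn hστ hv]
  exact one_ne_zero

end IsSnowflake

end Snowflake

/-! ### Lengths in snowflake groups -/

section SnowflakeLength

variable {G : Type*} [Group G]

/-- The cost of writing `a ^ n` next to a stable letter and its inverse. -/
noncomputable def conjCost (S : Set G) (a : G) (n : ℤ) : ℤ :=
  if n = 0 then 0 else wordLength S (a ^ n) + 2

theorem wordLength_le_conjCost (S : Set G) (a : G) (n : ℤ) :
    (wordLength S (a ^ n) : ℤ) ≤ conjCost S a n := by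
  unfold conjCost
  split_ifs with h
  · simp [h, wordLength_one]
  · omega

theorem wordLength_lt_conjCost (S : Set G) (a : G) {n : ℤ} (hn : n ≠ 0) :
    (wordLength S (a ^ n) : ℤ) < conjCost S a n := by
  rw [conjCost, if_neg hn]
  omega

theorem conjCost_add_le {S : Set G} (hS : IsSymmGenSet S) (a : G) (m n : ℤ) :
    conjCost S a (m + n) ≤ wordLength S (a ^ m) + 2 + conjCost S a n := by
  have h := hS.wordLength_mul_le (a ^ m) (a ^ n)
  rw [← zpow_add] at h
  unfold conjCost
  split_ifs with h1 h2 h2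
  · omega
  · omega
  · subst h2
    simp
  · omega

theorem IsSymmGenSet.wordLength_zpow_le {S : Set G} (hS : IsSymmGenSet S) {a : G} (ha : a ∈ S)
    (n : ℤ) : (wordLength S (a ^ n) : ℤ) ≤ |n| := by
  have hnat : ∀ k : ℕ, wordLength S (a ^ k) ≤ k := fun k => by
    simpa using wordLength_prod_le (l := List.replicate k a) fun x hx =>
      (List.eq_of_mem_replicate hx).symm ▸ ha
  obtain ⟨k, rfl | rfl⟩ := n.eq_nat_or_neg
  · simpa using hnat k
  · simpa [hS.wordLength_inv] using hnat k

namespace IsSnowflake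

variable {r : ℕ} {a b : G} {e : Bool → G} {χ : Bool → G → ℤ}

local notation "ℓ" => wordLength (stableGens a e)

theorem mul_zpow_zpow (H : IsSnowflake r a b e χ) (x y x' y' : ℤ) :
    a ^ x * b ^ y * (a ^ x' * b ^ y') = a ^ (x + x') * b ^ (y + y') := by
  rw [zpow_add, zpow_add, mul_assoc, mul_assoc, ← mul_assoc (b ^ y), ← mul_assoc (a ^ x'),
    ((H.comm.zpow_zpow x' y).eq), mul_assoc]

theorem conj_zpow (H : IsSnowflake r a b e χ) (σ : Bool) (m : ℤ) :
    (e σ)⁻¹ * a ^ m * e σ = a ^ (r * m) * b ^ (edgeSign σ * m) := by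
  have h1 := _root_.conj_zpow (i := m) (a := (e σ)⁻¹) (b := a)
  rw [inv_inv, H.conj, (H.comm.zpow_zpow _ _).mul_zpow, ← zpow_mul, ← zpow_mul] at h1
  exact h1.symm

theorem cross_zpow_zpow (H : IsSnowflake r a b e χ)
    (σ : Bool) (x y : ℤ) : χ σ (a ^ x * b ^ y) = 0 := by
  rw [H.cross_mul_zpow_b, H.cross_zpow_a]

theorem cross_stable_mul_zpow_zpow (H : IsSnowflake r a b e χ) (σ : Bool) (x y : ℤ) :
    χ σ (e σ * (a ^ x * b ^ y)) = 1 := by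
  rw [← mul_assoc, H.cross_mul_zpow_b, H.cross_mul_zpow_a, H.cross_stable]

/-- A short word for an element of `⟨a, b⟩` comes from powers of `a` and of its conjugates. -/
theorem exists_decomposition (H : IsSnowflake r a b e χ)
    (N : ℕ) (x y : ℤ) (hN : ℓ (a ^ x * b ^ y) = N) :
    ∃ X p q : ℤ, x = X + r * (p + q) ∧ y = p - q ∧
      |X| + conjCost (stableGens a e) a p + conjCost (stableGens a e) a q ≤ N := by
  have hS := H.isSymmGenSet
  induction N using Nat.strong_induction_on generalizing x y with
  | _ N ih =>
  rcases N with _ | N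
  · obtain ⟨rfl, rfl⟩ := H.inj x y (hS.eq_one_of_wordLength_eq_zero hN)
    exact ⟨0, 0, 0, by simp [conjCost]⟩
  obtain ⟨w, hw, h, hz, hh⟩ := hS.exists_eq_mul hN
  have hpow : ∀ ε : ℤ, |ε| = 1 → w = a ^ ε → ∃ X p q : ℤ, x = X + r * (p + q) ∧ y = p - q ∧
      |X| + conjCost (stableGens a e) a p + conjCost (stableGens a e) a q ≤ (N + 1 : ℕ) := by
    intro ε hε hwε
    have hh' : h = a ^ (x - ε) * b ^ y := by
      rw [eq_inv_mul_of_mul_eq hz.symm, hwε, ← zpow_neg, ← mul_assoc, ← zpow_add]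
      congr 2
      ring
    obtain ⟨X, p, q, h1, h2, h3⟩ := ih N (by omega) (x - ε) y (by rw [← hh', hh])
    refine ⟨X + ε, p, q, by linarith, h2, ?_⟩
    have := abs_add_le X ε
    push_cast
    linarith
  rcases hw with rfl | rfl | ⟨σ, rfl | rfl⟩
  · exact hpow 1 rfl (zpow_one _).symm
  · exact hpow (-1) rfl (zpow_neg_one _).symm
  · exfalso
    obtain ⟨h₁, w, hw, h₂, rfl, hlen, hlt⟩ := hS.exists_letter_lt (fun g => χ σ (e σ * g)) (g := h)
      (by rw [← hz, H.cross_zpow_zpow, mul_one, H.cross_stable]; exact one_pos)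
    rw [← mul_assoc] at hlt
    obtain ⟨rfl, n, hn⟩ := H.eq_of_lt_cross hw hlt
    have hn : a ^ n = e σ * h₁ * (e σ)⁻¹ := hn
    have hz' : a ^ x * b ^ y = a ^ n * h₂ := by rw [hz, hn]; group
    have hc : h₁ = a ^ (r * n) * b ^ (edgeSign σ * n) := by
      rw [← H.conj_zpow, hn]; group
    obtain ⟨X, p, q, -, h2, h3⟩ := ih _ (by omega) _ _ (congrArg (ℓ) hc.symm)
    have hle : (ℓ (a ^ n) : ℤ) ≤ ℓ (a ^ p) + ℓ (a ^ q) := by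
      have h4 := hS.wordLength_mul_le (a ^ p) (a ^ q)⁻¹
      rw [← zpow_neg, ← zpow_add, zpow_neg, hS.wordLength_inv, ← sub_eq_add_neg, ← h2] at h4
      cases σ
      · simpa [edgeSign] using (Nat.cast_le (α := ℤ)).2 h4
      · simpa [edgeSign, hS.wordLength_inv] using (Nat.cast_le (α := ℤ)).2 h4
    have h5 := wordLength_le_conjCost (stableGens a e) a p
    have h6 := wordLength_le_conjCost (stableGens a e) a q
    have h7 := hS.wordLength_mul_le (a ^ n) h₂
    rw [← hz', hN] at h7
    have := abs_nonneg X
    omega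
  · have hh' : h = e σ * (a ^ x * b ^ y) := by rw [hz, mul_inv_cancel_left]
    obtain ⟨h₁, w, hw, h₂, rfl, hlen, hlt⟩ := hS.exists_letter_lt (fun g => - χ σ g) (g := h)
      (by rw [hh', H.cross_stable_mul_zpow_zpow, H.cross_one]; norm_num)
    obtain ⟨rfl, p, hp⟩ := H.eq_of_cross_lt hw (neg_lt_neg_iff.1 hlt)
    have hp : a ^ p = h₁ := hp
    subst hp
    have hc : h₂ = a ^ (x - r * p) * b ^ (y - edgeSign σ * p) := by
      have h1 : a ^ x * b ^ y = a ^ (r * p) * b ^ (edgeSign σ * p) * h₂ := by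
        rw [hz, ← H.conj_zpow]; group
      have h2 := H.mul_zpow_zpow (r * p) (edgeSign σ * p) (x - r * p) (y - edgeSign σ * p)
      rw [add_sub_cancel, add_sub_cancel, h1] at h2
      exact (mul_left_cancel h2).symm
    obtain ⟨X, p', q', h1, h2, h3⟩ := ih _ (by omega) _ _ (congrArg (ℓ) hc.symm)
    cases σ
    · refine ⟨X, p + p', q', by linarith, by simp only [edgeSign] at h2; linarith, ?_⟩
      have := conjCost_add_le hS a p p'
      omega
    · refine ⟨X, p', p + q', by linarith, by simp only [edgeSign] at h2; linarith, ?_⟩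
      have := conjCost_add_le hS a p q'
      omega

/-- Powers of the two conjugates of `a` do not shorten each other. -/
theorem wordLength_add_le_conj (H : IsSnowflake r a b e χ) (hr : 2 ≤ r) (m n : ℤ) :
    ℓ (a ^ m) + ℓ (a ^ n) ≤
      ℓ ((e false)⁻¹ * a ^ m * e false * ((e true)⁻¹ * a ^ n * e true)) ∧
    (ℓ (a ^ m) + ℓ (a ^ n) =
      ℓ ((e false)⁻¹ * a ^ m * e false * ((e true)⁻¹ * a ^ n * e true)) → m = 0 ∧ n = 0) := by
  have hS := H.isSymmGenSet
  rw [H.conj_zpow, H.conj_zpow, H.mul_zpow_zpow]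
  obtain ⟨X, p, q, h1, h2, h3⟩ := H.exists_decomposition _ (r * m + r * n)
    (edgeSign false * m + edgeSign true * n) rfl
  simp only [edgeSign] at h2 h3 ⊢
  obtain ⟨i, rfl⟩ : ∃ i, m = p + i := ⟨m - p, by ring⟩
  obtain rfl : n = q + i := by linarith
  have hX : X = 2 * r * i := by linarith
  have hXi : |X| = 2 * r * |i| := by rw [hX, abs_mul, abs_of_nonneg (by positivity)]
  have hi := abs_nonneg i
  have hr' : (2 : ℤ) ≤ r := mod_cast hr
  have hXi' : 4 * |i| ≤ |X| := by rw [hXi]; nlinarith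
  have hp := hS.wordLength_mul_le (a ^ p) (a ^ i)
  have hq := hS.wordLength_mul_le (a ^ q) (a ^ i)
  rw [← zpow_add] at hp hq
  have hai := hS.wordLength_zpow_le (Or.inl rfl) i
  have h5 := wordLength_le_conjCost (stableGens a e) a p
  have h6 := wordLength_le_conjCost (stableGens a e) a q
  refine ⟨by omega, fun heq => ?_⟩
  have hi0 : i = 0 := abs_eq_zero.1 (by omega)
  have hp0 : p = 0 := by
    by_contra hp0
    have := wordLength_lt_conjCost (stableGens a e) a hp0
    omega
  have hq0 : q = 0 := by
    by_contra hq0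
    have := wordLength_lt_conjCost (stableGens a e) a hq0
    omega
  omega

end IsSnowflake

end SnowflakeLength

/-! ### Turns are bottlenecks -/

section SnowflakeTurn

variable {G : Type*} [Group G]

namespace IsSnowflake

variable {r : ℕ} {a b : G} {e : Bool → G} {χ : Bool → G → ℤ}

local notation "ℓ" => wordLength (stableGens a e)

/-- Every path from `1` to `u * (e false * (e true)⁻¹ * v)` crosses the two edges of the turn. -/
theorem exists_eq_append_of_prod_eq (H : IsSnowflake r a b e χ)
    {u v : G} (hu : χ false u⁻¹ = 0) (hv : χ true v = 0)
    {l : List G} (hl : ∀ x ∈ l, x ∈ stableGens a e)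
    (hprod : l.prod = u * (e false * (e true)⁻¹ * v)) :
    ∃ (l₁ l₂ l₃ : List G) (m n : ℤ), l = l₁ ++ e false :: (l₂ ++ (e true)⁻¹ :: l₃) ∧
      l₁.prod = u * a ^ m ∧
      l₂.prod = (e false)⁻¹ * a ^ (-m) * e false * ((e true)⁻¹ * a ^ n * e true) ∧
      l₃.prod = a ^ (-n) * v := by
  obtain ⟨l₁, x, l', rfl, hlt⟩ := l.exists_letter_lt (fun g => -χ false (u⁻¹ * g)) (by
    rw [hprod, inv_mul_cancel_left, H.cross_turn (by simp) hv, mul_one, hu]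
    norm_num)
  rw [neg_lt_neg_iff, ← mul_assoc] at hlt
  obtain ⟨rfl, m, hm⟩ := H.eq_of_cross_lt (hl _ (by simp)) hlt
  have hm : a ^ m = u⁻¹ * l₁.prod := hm
  have h₁ : l₁.prod = u * a ^ m := by rw [hm, mul_inv_cancel_left]
  have h' : l'.prod = (e false)⁻¹ * a ^ (-m) * e false * ((e true)⁻¹ * v) := by
    rw [List.prod_append, List.prod_cons, h₁, mul_assoc u] at hprod
    have h2 := mul_left_cancel hprod
    rw [← eq_inv_mul_iff_mul_eq, ← eq_inv_mul_iff_mul_eq] at h2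
    rw [h2]
    group
  obtain ⟨l₂, x, l₃, rfl, hlt⟩ := l'.exists_letter_lt
    (fun g => χ true (e true * ((e false)⁻¹ * a ^ m * e false) * g)) (by
      rw [mul_one, H.conj_zpow, H.cross_stable_mul_zpow_zpow, h']
      rw [show e true * (a ^ (r * m) * b ^ (edgeSign false * m)) *
        ((e false)⁻¹ * a ^ (-m) * e false * ((e true)⁻¹ * v)) = v by rw [← H.conj_zpow]; group, hv]
      exact one_pos)
  rw [← mul_assoc] at hlt
  obtain ⟨rfl, n, hn⟩ := H.eq_of_lt_cross (hl _ (by simp)) hlt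
  have hn : a ^ n = e true * ((e false)⁻¹ * a ^ m * e false) * l₂.prod * (e true)⁻¹ := hn
  refine ⟨l₁, l₂, l₃, m, n, rfl, h₁, by rw [hn]; group, ?_⟩
  rw [List.prod_append, List.prod_cons] at h'
  rw [zpow_neg, hn, eq_inv_mul_iff_mul_eq, mul_assoc, mul_assoc, h']
  group

/-- Lengths are additive at a turn, and geodesics run through it. -/
theorem turn_geodesic (H : IsSnowflake r a b e χ)
    (hr : 2 ≤ r) {u v : G} (hu : χ false u⁻¹ = 0) (hv : χ true v = 0) :
    ℓ (u * (e false * (e true)⁻¹ * v)) = ℓ u + 2 + ℓ v ∧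
    ∀ l : List G, (∀ x ∈ l, x ∈ stableGens a e) → l.prod = u * (e false * (e true)⁻¹ * v) →
      l.length = ℓ l.prod →
      ∃ l₁ l₃ : List G, l = l₁ ++ [e false, (e true)⁻¹] ++ l₃ ∧ l₁.prod = u ∧ l₁.length = ℓ u := by
  have hS := H.isSymmGenSet
  have hle : ℓ (u * (e false * (e true)⁻¹ * v)) ≤ ℓ u + 2 + ℓ v := by
    have h1 := hS.wordLength_mul_le u (e false * (e true)⁻¹ * v)
    have h2 := hS.wordLength_mul_le (e false * (e true)⁻¹) v
    have h3 := hS.wordLength_mul_le (e false) (e true)⁻¹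
    have h4 : ℓ (e false) ≤ 1 := wordLength_le_one (Or.inr (Or.inr ⟨_, Or.inl rfl⟩))
    have h5 : ℓ (e true)⁻¹ ≤ 1 := wordLength_le_one (Or.inr (Or.inr ⟨_, Or.inr rfl⟩))
    omega
  have key : ∀ l : List G, (∀ x ∈ l, x ∈ stableGens a e) →
      l.prod = u * (e false * (e true)⁻¹ * v) → l.length = ℓ l.prod →
      ℓ u + 2 + ℓ v ≤ l.length ∧
      ∃ l₁ l₃ : List G, l = l₁ ++ [e false, (e true)⁻¹] ++ l₃ ∧ l₁.prod = u ∧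
        l₁.length = ℓ u := by
    intro l hl hprod hlen
    obtain ⟨l₁, l₂, l₃, m, n, rfl, h₁, h₂, h₃⟩ := H.exists_eq_append_of_prod_eq hu hv hl hprod
    rw [hprod] at hlen
    simp only [List.length_append, List.length_cons] at hlen ⊢
    have k₁ := wordLength_prod_le (l := l₁) fun x hx => hl x (by simp [hx])
    have k₂ := wordLength_prod_le (l := l₂) fun x hx => hl x (by simp [hx])
    have k₃ := wordLength_prod_le (l := l₃) fun x hx => hl x (by simp [hx])
    obtain ⟨hc, heq⟩ := H.wordLength_add_le_conj hr (-m) n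
    rw [← h₂] at hc heq
    have hu' := hS.wordLength_mul_le (u * a ^ m) (a ^ (-m))
    rw [mul_assoc, ← zpow_add, add_neg_cancel, zpow_zero, mul_one, ← h₁] at hu'
    have hv' := hS.wordLength_mul_le (a ^ n) (a ^ (-n) * v)
    rw [← mul_assoc, ← zpow_add, add_neg_cancel, zpow_zero, one_mul, ← h₃] at hv'
    refine ⟨by omega, l₁, l₃, ?_⟩
    obtain ⟨hm, rfl⟩ := heq (by omega)
    obtain rfl := neg_eq_zero.1 hm
    simp only [neg_zero, zpow_zero, mul_one, one_mul, inv_mul_cancel] at h₁ h₂ h₃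
    rw [h₁] at k₁ hu'
    rw [h₂] at k₂ hc
    rw [h₃] at k₃
    have : l₂ = [] := List.length_eq_zero_iff.1 (by omega)
    subst this
    exact ⟨by simp, h₁, by omega⟩
  refine ⟨?_, fun l hl hprod hlen => (key l hl hprod hlen).2⟩
  obtain ⟨l, hl, hprod, hlen⟩ := hS.exists_geodesic_word (u * (e false * (e true)⁻¹ * v))
  have := (key l hl hprod (by rw [hlen, hprod])).1
  omega

theorem wordLength_turn (H : IsSnowflake r a b e χ)
    (hr : 2 ≤ r) {u v : G} (hu : χ false u⁻¹ = 0) (hv : χ true v = 0) :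
    ℓ (u * (e false * (e true)⁻¹ * v)) = ℓ u + 2 + ℓ v :=
  (H.turn_geodesic hr hu hv).1

/-- An initial piece of a geodesic that is long enough contains the part before a turn, and then
the turn. -/
theorem exists_eq_mul_of_turn (H : IsSnowflake r a b e χ)
    (hr : 2 ≤ r) {u v x z : G} (hu : χ false u⁻¹ = 0)
    (hv : χ true v = 0) (hxz : x * z = u * (e false * (e true)⁻¹ * v))
    (hlen : ℓ x + ℓ z = ℓ (x * z)) :
    (ℓ u ≤ ℓ x → ∃ y, x = u * y ∧ ℓ u + ℓ y ≤ ℓ x) ∧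
    (ℓ u + 2 ≤ ℓ x → ∃ y, x = u * (e false * (e true)⁻¹ * y) ∧ ℓ u + 2 + ℓ y ≤ ℓ x) := by
  have hS := H.isSymmGenSet
  obtain ⟨lx, hlx, rfl, hx⟩ := hS.exists_geodesic_word x
  obtain ⟨lz, hlz, rfl, hz⟩ := hS.exists_geodesic_word z
  rw [← List.prod_append] at hxz hlen
  obtain ⟨l₁, l₃, heq, rfl, h₁⟩ := (H.turn_geodesic hr hu hv).2 _
    (fun x hx => (List.mem_append.1 hx).elim (hlx x) (hlz x)) hxz
    (by rw [List.length_append]; omega)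
  constructor
  · intro h
    have hp : l₁ <+: lx := List.prefix_of_prefix_length_le
      (l₃ := lx ++ lz) (by rw [heq, List.append_assoc]; exact List.prefix_append _ _)
      (List.prefix_append _ _) (by omega)
    obtain ⟨k, rfl⟩ := hp
    refine ⟨k.prod, List.prod_append, ?_⟩
    have := wordLength_prod_le (l := k) fun x hx => hlx x (by simp [hx])
    rw [List.length_append] at hx
    omega
  · intro h
    have hp : l₁ ++ [e false, (e true)⁻¹] <+: lx := List.prefix_of_prefix_length_le
      (l₃ := lx ++ lz) (by rw [heq]; exact List.prefix_append _ _)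
      (List.prefix_append _ _) (by rw [List.length_append, h₁, hx]; exact h)
    obtain ⟨k, rfl⟩ := hp
    refine ⟨k.prod, by simp [mul_assoc], ?_⟩
    have := wordLength_prod_le (l := k) fun x hx => hlx x (by simp [hx])
    simp only [List.length_append, List.length_cons, List.length_nil] at hx
    omega

end IsSnowflake

end SnowflakeTurn

/-! ### Growth tightness of snowflake groups -/

section SnowflakeGraft

variable {G : Type*} [Group G]

/-- Records which half-trees at the base vertex separate it from its translates. -/
noncomputable def turnClass (χ : Bool → G → ℤ) (g : G) : Bool × Bool :=
  (decide (χ false g⁻¹ = 0), decide (χ true g = 0))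

namespace IsSnowflake

variable {r : ℕ} {a b : G} {e : Bool → G} {χ : Bool → G → ℤ}

local notation "ℓ" => wordLength (stableGens a e)

/-- Elements in a fixed class that are shortest modulo an infinite normal subgroup can be
concatenated through suitable turns. -/
theorem graftable (H : IsSnowflake r a b e χ)
    (hr : 2 ≤ r) (Γ : Subgroup G) (hΓ : Γ.Normal) (hinf : (Γ : Set G).Infinite)
    (c : Bool × Bool) :
    Graftable (stableGens a e) {g | turnClass χ g = c ∧ ∀ γ ∈ Γ, ℓ g ≤ ℓ (g * γ)} := by
  have hS := H.isSymmGenSet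
  have hshift : ∀ σ h, ∃ i : ℤ, ℓ (b ^ i) ≤ ℓ b ∧ χ σ (b ^ i * h) = 0 := fun σ h => by
    by_cases hh : χ σ h = 0
    · exact ⟨0, by simp [wordLength_one], by simpa using hh⟩
    · exact ⟨-1, by simp [hS.wordLength_inv], by simpa using H.cross_inv_b_mul σ hh⟩
  obtain ⟨p, hpl, hp⟩ : ∃ p : ℤ, ℓ (b ^ p) ≤ ℓ b ∧
      ∀ g, turnClass χ g = c → χ false (g * b ^ p)⁻¹ = 0 := by
    rcases hc : c.1 with _ | _
    · refine ⟨1, by simp, fun g hg => ?_⟩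
      subst hg
      rw [mul_inv_rev, zpow_one]
      exact H.cross_inv_b_mul _ (by simpa [turnClass] using hc)
    · refine ⟨0, by simp [wordLength_one], fun g hg => ?_⟩
      subst hg
      simpa [turnClass] using hc
  obtain ⟨q, hq⟩ : ∃ q : ℤ, ∀ g, turnClass χ g = c → χ true (b ^ q * g) = 0 := by
    rcases hc : c.2 with _ | _
    · refine ⟨-1, fun g hg => ?_⟩
      subst hg
      rw [zpow_neg_one]
      exact H.cross_inv_b_mul _ (by simpa [turnClass] using hc)
    · refine ⟨0, fun g hg => ?_⟩
      subst hg
      simpa [turnClass] using hc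
  obtain ⟨γ, hγ, hγl⟩ := hinf.exists_notMem_finite (hS.finite_ball (6 * ℓ b))
  have hγl : 6 * ℓ b < ℓ γ := not_le.1 hγl
  obtain ⟨i, hil, hi⟩ := hshift true γ
  obtain ⟨j, hjl, hj⟩ := hshift false γ⁻¹
  obtain ⟨y, hy⟩ : ∃ y, y = b ^ i * γ * b ^ (-j) := ⟨_, rfl⟩
  have hyt : χ true y = 0 := by rw [hy, H.cross_mul_zpow_b, hi]
  have hys : χ false y⁻¹ = 0 := by
    rw [hy, mul_inv_rev, mul_inv_rev, ← zpow_neg, ← zpow_neg, neg_neg, ← mul_assoc,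
      H.cross_mul_zpow_b, hj]
  have hyl : 4 * ℓ b < ℓ y := by
    have h1 := hS.wordLength_mul_le (b ^ (-i)) (y * b ^ j)
    have h2 := hS.wordLength_mul_le y (b ^ j)
    have h3 : b ^ (-i) * (y * b ^ j) = γ := by rw [hy]; group
    rw [h3, zpow_neg, hS.wordLength_inv] at h1
    omega
  obtain ⟨k, hk⟩ : ∃ k, k =
      b ^ p * (e false * (e true)⁻¹ * (y * (e false * (e true)⁻¹ * b ^ q))) := ⟨_, rfl⟩
  have hakw : ∀ g w, g * k * w = g * b ^ p *
      (e false * (e true)⁻¹ * (y * (e false * (e true)⁻¹ * (b ^ q * w)))) := fun g w => by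
    rw [hk]; group
  have hturn : ∀ {w}, χ true (b ^ q * w) = 0 →
      χ true (y * (e false * (e true)⁻¹ * (b ^ q * w))) = 0 := fun hw =>
    H.cross_mul_turn (by simp) hys hyt hw
  have overlap : ∀ g g' w w', turnClass χ g = c → turnClass χ g' = c →
      (∀ γ ∈ Γ, ℓ g' ≤ ℓ (g' * γ)) → χ true (b ^ q * w) = 0 → χ true (b ^ q * w') = 0 →
      g * k * w = g' * k * w' → ℓ (g * b ^ p) ≤ ℓ (g' * b ^ p) →
      ℓ (g⁻¹ * g') ≤ ℓ y + 4 + 2 * ℓ b := by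
    intro g g' w w' hg hg' hmin hw hw' heq hle
    rw [hakw, hakw] at heq
    have hz := H.wordLength_turn hr (u := 1) (by simp [H.cross_one]) (hturn hw')
    have hxz := H.wordLength_turn hr (hp g' hg') (hturn hw')
    rw [one_mul, wordLength_one] at hz
    obtain ⟨x, hx, hxl⟩ := (H.exists_eq_mul_of_turn hr (hp g hg) (hturn hw) heq.symm
      (by omega)).1 hle
    by_cases hxy : ℓ x ≤ ℓ y + 4
    · have h1 : g⁻¹ * g' = b ^ p * x * (b ^ p)⁻¹ := by
        rw [eq_mul_inv_iff_mul_eq, mul_assoc, hx]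
        group
      have h2 := hS.wordLength_mul_le (b ^ p * x) (b ^ p)⁻¹
      have h3 := hS.wordLength_mul_le (b ^ p) x
      rw [hS.wordLength_inv] at h2
      rw [h1]
      omega
    exfalso
    have hu : χ false (g * b ^ p * (e false * (e true)⁻¹ * y))⁻¹ = 0 := by
      have := H.cross_mul_turn (σ := true) (τ := false) (y := y⁻¹) (by simp)
        (by rwa [inv_inv]) hys (hp g hg)
      rwa [show (g * b ^ p * (e false * (e true)⁻¹ * y))⁻¹ =
        y⁻¹ * (e true * (e false)⁻¹ * (g * b ^ p)⁻¹) by group]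
    have hul := H.wordLength_turn hr (hp g hg) hyt
    obtain ⟨z, hz', hzl⟩ := (H.exists_eq_mul_of_turn hr (x := g' * b ^ p) hu hw
      (by rw [← heq]; group) (by omega)).2 (by omega)
    obtain ⟨d, hd⟩ : ∃ d, d = b ^ (-j) * (e false * (e true)⁻¹ * z) * b ^ (-p) := ⟨_, rfl⟩
    have hg'd : g' = g * b ^ p * (e false * (e true)⁻¹) * b ^ i * γ * d := by
      rw [eq_mul_inv_of_mul_eq hz', hd, hy]
      group
    have hcomp : g' * (d⁻¹ * γ⁻¹ * d) =
        g * b ^ p * (e false * (e true)⁻¹ * (b ^ i * d)) := by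
      rw [hg'd]; group
    have hmin' := hmin (d⁻¹ * γ⁻¹ * d) (by
      simpa using hΓ.conj_mem _ (inv_mem hγ) d⁻¹)
    rw [hcomp] at hmin'
    have hτ : ℓ (e false * (e true)⁻¹) ≤ 2 := by
      have h3 := hS.wordLength_mul_le (e false) (e true)⁻¹
      have h4 : ℓ (e false) ≤ 1 := wordLength_le_one (Or.inr (Or.inr ⟨_, Or.inl rfl⟩))
      have h5 : ℓ (e true)⁻¹ ≤ 1 := wordLength_le_one (Or.inr (Or.inr ⟨_, Or.inr rfl⟩))
      omega
    have k1 := hS.wordLength_mul_le (g * b ^ p) (e false * (e true)⁻¹ * (b ^ i * d))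
    have k2 := hS.wordLength_mul_le (e false * (e true)⁻¹) (b ^ i * d)
    have k3 := hS.wordLength_mul_le (b ^ i) d
    have k4 := hS.wordLength_mul_le (b ^ (-j) * (e false * (e true)⁻¹ * z)) (b ^ (-p))
    have k5 := hS.wordLength_mul_le (b ^ (-j)) (e false * (e true)⁻¹ * z)
    have k6 := hS.wordLength_mul_le (e false * (e true)⁻¹) z
    have k7 := hS.wordLength_mul_le g' (b ^ p)
    have k8 : ℓ (b ^ (-p)) ≤ ℓ b := by rwa [zpow_neg, hS.wordLength_inv]
    have k9 : ℓ (b ^ (-j)) ≤ ℓ b := by rwa [zpow_neg, hS.wordLength_inv]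
    rw [← hd] at k4
    omega
  refine ⟨{w | χ true (b ^ q * w) = 0}, k, ℓ k, ℓ y + 4 + 2 * ℓ b, ?_, ?_⟩
  · simpa using H.cross_zpow_b true q
  rintro g ⟨hg, hgmin⟩ w hw
  refine ⟨?_, ?_, ?_⟩
  · show χ true (b ^ q * (g * k * w)) = 0
    rw [hakw, ← mul_assoc]
    refine H.cross_mul_turn (by simp) ?_ ?_ (hturn hw)
    · rw [mul_inv_rev, ← zpow_neg, H.cross_mul_zpow_b, hp g hg]
    · rw [← mul_assoc, H.cross_mul_zpow_b, hq g hg]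
  · have h1 := hS.wordLength_mul_le (g * k) w
    have h2 := hS.wordLength_mul_le g k
    omega
  · rintro g' ⟨hg', hgmin'⟩ w' hw' heq
    rcases le_total (ℓ (g * b ^ p)) (ℓ (g' * b ^ p)) with hle | hle
    · exact overlap g g' w w' hg hg' hgmin' hw hw' heq hle
    · have := overlap g' g w' w hg' hg hgmin hw' hw heq.symm hle
      rwa [← hS.wordLength_inv, mul_inv_rev, inv_inv] at this

end IsSnowflake

end SnowflakeGraft

/-! ### The presented snowflake groups -/

section SnowflakePresentation

namespace IsSnowflake

/-- Products of stable letters are distinguished by expansions in base `r`. -/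
theorem two_pow_le_card {G : Type*} [Group G] {r : ℕ} {a b : G} {e : Bool → G}
    {χ : Bool → G → ℤ} (H : IsSnowflake r a b e χ) (hr : 2 ≤ r) (φ : G →* Equiv.Perm ℚ)
    (hφ : ∀ σ x, φ (e σ) x = x / r + if σ then 1 else 0) (N : ℕ) :
    (2 : ℝ) ^ N ≤ Nat.card {g : G // wordLength (stableGens a e) g ≤ N} := by
  have hr' : (2 : ℚ) ≤ r := mod_cast hr
  have hval : ∀ (σ : Bool) (w : List Bool), φ ((σ :: w).map e).prod 0 =
      φ (w.map e).prod 0 / r + if σ then 1 else 0 := fun σ w => by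
    rw [List.map_cons, List.prod_cons, map_mul, Equiv.Perm.mul_apply, hφ]
  have hbound : ∀ w : List Bool, 0 ≤ φ (w.map e).prod 0 ∧ φ (w.map e).prod 0 < 2 := by
    intro w
    induction w with
    | nil => simp
    | cons σ w ih =>
      rw [hval]
      have h1 : 0 ≤ φ (w.map e).prod 0 / r := div_nonneg ih.1 (by linarith)
      have h2 : φ (w.map e).prod 0 / r < 1 := (div_lt_one (by linarith)).2 (by linarith [ih.2])
      cases σ <;> simp <;> constructor <;> linarith
  have hinj : ∀ w w' : List Bool, w.length = w'.length →
      (w.map e).prod = (w'.map e).prod → w = w' := by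
    intro w
    induction w with
    | nil => exact fun w' h _ => (List.length_eq_zero_iff.1 h.symm).symm
    | cons σ w ih =>
      intro w' hlen heq
      obtain _ | ⟨σ', w'⟩ := w'
      · simp at hlen
      have hval' := hval σ w
      rw [heq, hval] at hval'
      have hdigit : ∀ w : List Bool, 0 ≤ φ (w.map e).prod 0 / r ∧ φ (w.map e).prod 0 / r < 1 :=
        fun w => ⟨div_nonneg (hbound w).1 (by linarith),
          (div_lt_one (by linarith)).2 (by linarith [(hbound w).2])⟩
      have hσ : σ = σ' := by
        have h1 := hdigit w
        have h2 := hdigit w'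
        cases σ <;> cases σ' <;> simp at hval' ⊢ <;> linarith
      subst hσ
      rw [ih w' (by simpa using hlen) (by simpa using heq)]
  have := (H.isSymmGenSet.finite_ball N).to_subtype
  have hcard := Nat.card_le_card_of_injective
    (fun w : List.Vector Bool N =>
      (⟨(w.1.map e).prod, (wordLength_prod_le fun x hx => by
        obtain ⟨σ, -, rfl⟩ := List.mem_map.1 hx
        exact Or.inr (Or.inr ⟨σ, Or.inl rfl⟩)).trans (by simp [w.2])⟩ :
        {g : G | wordLength (stableGens a e) g ≤ N}))
    (fun w w' h => Subtype.ext (hinj _ _ (by rw [w.2, w'.2]) (Subtype.ext_iff.1 h)))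
  rw [Nat.card_eq_fintype_card, card_vector, Fintype.card_bool] at hcard
  exact mod_cast hcard

end IsSnowflake

/-- Left translation by `x`, recording with the weight `J` where one arrives. -/
def weightedTranslation {G : Type*} [Group G] (x : G) (J : G → ℤ) : Equiv.Perm (G × ℤ) where
  toFun p := (x * p.1, p.2 - J (x * p.1))
  invFun p := (x⁻¹ * p.1, p.2 + J p.1)
  left_inv p := by simp
  right_inv p := by simp

variable {r : ℕ}

theorem snowflake_lift {M : Type*} [Group M] {A B S T : M} (hAB : A * B = B * A)
    (hS : A * S = S * (A ^ r * B)) (hT : A * T = T * (A ^ r * B⁻¹)) :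
    ∃ φ : PresentedGroup (snowflakeRels r) →* M, φ (.of 0) = A ∧ φ (.of 1) = B ∧
      φ (.of 2) = S ∧ φ (.of 3) = T := by
  have h : ∀ w ∈ snowflakeRels r, FreeGroup.lift ![A, B, S, T] w = 1 := by
    rintro w (rfl | rfl | rfl)
    · simp [hAB]
    · rw [map_mul, map_inv, mul_inv_eq_one]
      simp [mul_assoc, hS]
    · rw [map_mul, map_inv, mul_inv_eq_one]
      simp [mul_assoc, hT]
  exact ⟨PresentedGroup.toGroup h, by simp, by simp, by simp, by simp⟩

/-- Affine actions of the snowflake group on the line. -/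
theorem snowflake_affine (β c : ℚ) (h₁ : r + β ≠ 0) (h₂ : r - β ≠ 0) :
    ∃ φ : PresentedGroup (snowflakeRels r) →* Equiv.Perm ℚ,
      (∀ (n : ℤ) x, φ (.of 0 ^ n) x = x + n) ∧ (∀ (n : ℤ) x, φ (.of 1 ^ n) x = x + n * β) ∧
      (∀ x, φ (.of 2) x = x / (r + β)) ∧ ∀ x, φ (.of 3) x = x / (r - β) + c := by
  obtain ⟨φ, hA, hB, hS, hT⟩ := snowflake_lift (r := r) (A := Equiv.addRight (1 : ℚ))
    (B := Equiv.addRight β) (S := (Equiv.mulRight₀ _ h₁)⁻¹)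
    (T := Equiv.addRight c * (Equiv.mulRight₀ _ h₂)⁻¹)
    (by ext x; simp [add_right_comm])
    (by ext x; simp [Equiv.Perm.inv_def]; field_simp; ring)
    (by ext x; simp [Equiv.Perm.inv_def]; field_simp; ring)
  refine ⟨φ, fun n x => ?_, fun n x => ?_, fun x => ?_, fun x => ?_⟩
  · simp [hA]
  · simp [hB]
  · simp [hS, Equiv.Perm.inv_def, div_eq_mul_inv]
  · simp [hT, Equiv.Perm.inv_def, div_eq_mul_inv]

theorem snowflake_commute (r : ℕ) :
    Commute (.of 0 : PresentedGroup (snowflakeRels r)) (.of 1) := by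
  have h := PresentedGroup.one_of_mem (rels := snowflakeRels r) (Or.inl rfl)
  rw [map_mul, map_inv, map_mul, map_inv, map_mul, mul_inv_eq_one, mul_inv_eq_iff_eq_mul] at h
  exact h

theorem snowflake_conj (r : ℕ) :
    (.of 2 : PresentedGroup (snowflakeRels r))⁻¹ * .of 0 * .of 2 = .of 0 ^ r * .of 1 := by
  have h := PresentedGroup.one_of_mem (rels := snowflakeRels r) (Or.inr (Or.inl rfl))
  rw [map_mul, map_inv, mul_inv_eq_one, map_mul, map_mul, map_mul, map_inv, map_pow] at h
  exact h

theorem snowflake_conj' (r : ℕ) :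
    (.of 3 : PresentedGroup (snowflakeRels r))⁻¹ * .of 0 * .of 3 = .of 0 ^ r * (.of 1)⁻¹ := by
  have h := PresentedGroup.one_of_mem (rels := snowflakeRels r) (Or.inr (Or.inr rfl))
  rw [map_mul, map_inv, mul_inv_eq_one, map_mul, map_mul, map_mul, map_inv, map_inv, map_pow] at h
  exact h

/-- The stable letters of the snowflake group. -/
def snowflakeStable (r : ℕ) (σ : Bool) : PresentedGroup (snowflakeRels r) :=
  cond σ (.of 3) (.of 2)

theorem snowflake_closure (r : ℕ) :
    Subgroup.closure {x : PresentedGroup (snowflakeRels r) |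
      x = .of 0 ∨ ∃ σ, x = snowflakeStable r σ} = ⊤ := by
  rw [eq_top_iff, ← PresentedGroup.closure_range_of, Subgroup.closure_le]
  have h0 := Subgroup.subset_closure (show (.of 0 : PresentedGroup (snowflakeRels r)) ∈
    {x | x = .of 0 ∨ ∃ σ, x = snowflakeStable r σ} from Or.inl rfl)
  have h2 := Subgroup.subset_closure (show (.of 2 : PresentedGroup (snowflakeRels r)) ∈
    {x | x = .of 0 ∨ ∃ σ, x = snowflakeStable r σ} from Or.inr ⟨false, rfl⟩)
  have h3 := Subgroup.subset_closure (show (.of 3 : PresentedGroup (snowflakeRels r)) ∈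
    {x | x = .of 0 ∨ ∃ σ, x = snowflakeStable r σ} from Or.inr ⟨true, rfl⟩)
  rintro _ ⟨i, rfl⟩
  fin_cases i
  · exact h0
  · show PresentedGroup.of 1 ∈ _
    rw [← inv_mul_eq_iff_eq_mul.2 (snowflake_conj r)]
    exact mul_mem (inv_mem (pow_mem h0 r)) (mul_mem (mul_mem (inv_mem h2) h0) h2)
  · exact h2
  · exact h3

open Classical in
/-- The weight that detects the base edge labelled `σ`. -/
noncomputable def edgeWeight (r : ℕ) (σ τ : Bool) (g : PresentedGroup (snowflakeRels r)) : ℤ :=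
  if τ = σ ∧ g ∈ Subgroup.zpowers (.of 0) then 1 else 0

/-- The crossing numbers of the base edges of the Bass–Serre tree. -/
theorem snowflake_cross (r : ℕ) (σ : Bool) :
    ∃ χ : PresentedGroup (snowflakeRels r) → ℤ, χ 1 = 0 ∧ (∀ g, χ (g * .of 0) = χ g) ∧
      (∀ g, χ (g * .of 1) = χ g) ∧
      ∀ τ g, χ (g * snowflakeStable r τ) = χ g + edgeWeight r σ τ g := by
  obtain ⟨L, hL⟩ : ∃ L : PresentedGroup (snowflakeRels r) →*
      Equiv.Perm (PresentedGroup (snowflakeRels r) × ℤ), ∀ x, L x = weightedTranslation x 0 :=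
    ⟨MonoidHom.mk' (fun x => weightedTranslation x 0) fun x y => by
      ext p <;> simp [weightedTranslation, mul_assoc], fun _ => rfl⟩
  have hw : ∀ τ (y : PresentedGroup (snowflakeRels r)),
      (.of 0 * snowflakeStable r τ = snowflakeStable r τ * y) →
      L (.of 0) * weightedTranslation (snowflakeStable r τ) (edgeWeight r σ τ) =
        weightedTranslation (snowflakeStable r τ) (edgeWeight r σ τ) * L y := by
    intro τ y h
    have hJ : ∀ g, edgeWeight r σ τ (.of 0 * g) = edgeWeight r σ τ g := fun g => by
      simp only [edgeWeight, Subgroup.mul_mem_cancel_left _ (Subgroup.mem_zpowers _)]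
    ext p <;> simp [hL, weightedTranslation, ← mul_assoc, ← h]
    rw [mul_assoc, hJ]
  obtain ⟨ρ, h0, h1, h2, h3⟩ := snowflake_lift (A := L (.of 0)) (B := L (.of 1))
    (S := weightedTranslation (snowflakeStable r false) (edgeWeight r σ false))
    (T := weightedTranslation (snowflakeStable r true) (edgeWeight r σ true))
    (by rw [← map_mul, ← map_mul, (snowflake_commute r).eq])
    (by
      rw [← map_pow, ← map_mul]
      exact hw _ _ (by rw [← snowflake_conj, mul_assoc]; exact (mul_inv_cancel_left _ _).symm))
    (by
      rw [← map_pow, ← map_inv, ← map_mul]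
      exact hw _ _ (by rw [← snowflake_conj', mul_assoc]; exact (mul_inv_cancel_left _ _).symm))
  have he : ∀ τ, ρ (snowflakeStable r τ) =
      weightedTranslation (snowflakeStable r τ) (edgeWeight r σ τ) := by
    rintro (_ | _)
    · exact h2
    · exact h3
  rw [hL] at h0 h1
  have hfst : ∀ g p, (ρ g p).1 = g * p.1 := by
    intro g
    have hg : g ∈ Subgroup.closure {x : PresentedGroup (snowflakeRels r) |
      x = .of 0 ∨ ∃ σ, x = snowflakeStable r σ} := by rw [snowflake_closure]; trivial
    induction hg using Subgroup.closure_induction with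
    | mem x hx =>
      rcases hx with rfl | ⟨τ, rfl⟩
      · rw [h0]; exact fun _ => rfl
      · rw [he]; exact fun _ => rfl
    | one => simp
    | mul x y _ _ hx hy => intro p; rw [map_mul, Equiv.Perm.mul_apply, hx, hy, mul_assoc]
    | inv x _ hx =>
      intro p
      rw [eq_inv_mul_iff_mul_eq, ← hx, map_inv, ← Equiv.Perm.mul_apply, mul_inv_cancel,
        Equiv.Perm.one_apply]
  have hmul : ∀ g x J, ρ x = weightedTranslation x J →
      (ρ (g * x)⁻¹ (1, 0)).2 = (ρ g⁻¹ (1, 0)).2 + J g⁻¹ := by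
    intro g x J hx
    rw [mul_inv_rev, map_mul, Equiv.Perm.mul_apply, map_inv ρ x, hx]
    show _ + J (ρ g⁻¹ (1, 0)).1 = _
    rw [hfst, mul_one]
  refine ⟨fun g => (ρ g⁻¹ (1, 0)).2, by simp, fun g => ?_, fun g => ?_, fun τ g => ?_⟩
  · simpa using hmul g _ _ h0
  · simpa using hmul g _ _ h1
  · simpa [edgeWeight] using hmul g _ _ (he τ)

theorem snowflake_isSnowflake (hr : 2 ≤ r) :
    ∃ χ, IsSnowflake r (.of 0) (.of 1) (snowflakeStable r) χ := by
  choose χ h1 ha hb he using snowflake_cross r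
  have hr' : (2 : ℚ) ≤ r := mod_cast hr
  refine ⟨χ, snowflake_commute r, ?_, ?_, snowflake_closure r, h1, ha, hb, ?_, ?_, ?_, ?_⟩
  · rintro (_ | _)
    · simpa [edgeSign, snowflakeStable] using snowflake_conj r
    · simpa [edgeSign, snowflakeStable] using snowflake_conj' r
  · intro m n h
    have key : ∀ β : ℚ, r + β ≠ 0 → r - β ≠ 0 → (n : ℚ) * β + m = 0 := by
      intro β h₁ h₂
      obtain ⟨φ, hA, hB, -⟩ := snowflake_affine β 0 h₁ h₂
      have h0 := congrArg (fun g => φ g 0) h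
      rw [map_mul, Equiv.Perm.mul_apply, hB, hA] at h0
      simpa using h0
    have h₁ := key 0 (by linarith) (by linarith)
    have h₂ := key 1 (by linarith) (by linarith)
    have hm : (m : ℚ) = 0 := by linarith
    have hn : (n : ℚ) = 0 := by linarith
    exact ⟨mod_cast hm, mod_cast hn⟩
  · intro σ τ g h
    rw [he, edgeWeight, if_neg (fun h' => h h'.1), add_zero]
  · intro σ g h
    rw [he, edgeWeight, if_neg (fun h' => h h'.2), add_zero]
  · intro σ
    have := he σ σ 1
    rwa [one_mul, h1, edgeWeight, if_pos ⟨rfl, one_mem _⟩, zero_add] at this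
  · intro σ g h
    rw [he, edgeWeight, if_pos ⟨rfl, h⟩]

end SnowflakePresentation

/-- **Theorem.** For `r ≥ 3`, the Brady–Bridson snowflake group `BB(1,r)` admits a
cocompact, growth tight action. -/
theorem snowflake_admits_cocompact_growth_tight_action (r : ℕ) (hr : 3 ≤ r) :
    ∃ (X : Type) (_ : MetricSpace X) (_ : MulAction (PresentedGroup (snowflakeRels r)) X)
      (o : X),
      ProperSpace X ∧ GeodesicSpace X ∧
      IsometricAction (PresentedGroup (snowflakeRels r)) X ∧
      ProperlyDiscontinuousAction (PresentedGroup (snowflakeRels r)) X ∧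
      (∃ K : Set X, IsCompact K ∧
        (⋃ g : PresentedGroup (snowflakeRels r), (g • ·) '' K) = Set.univ) ∧
      GrowthTight (PresentedGroup (snowflakeRels r)) o := by
  have hr' : (3 : ℚ) ≤ r := mod_cast hr
  obtain ⟨χ, H⟩ := snowflake_isSnowflake (by omega : 2 ≤ r)
  obtain ⟨φ, -, -, hs, ht⟩ := snowflake_affine (r := r) 0 1 (by linarith) (by linarith)
  have hφ : ∀ σ x, φ (snowflakeStable r σ) x = x / r + if σ then 1 else 0 := by
    rintro (_ | _) x
    · simpa [snowflakeStable] using hs x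
    · simpa [snowflakeStable] using ht x
  have hS := H.isSymmGenSet
  let x₀ : stableGens (.of 0) (snowflakeStable r) := ⟨.of 0, Or.inl rfl⟩
  exact ⟨CayleyGraph hS, inferInstance, inferInstance, CayleyGraph.vertex x₀ 1,
    CayleyGraph.properSpace x₀, CayleyGraph.geodesicSpace, CayleyGraph.isometricAction,
    CayleyGraph.properlyDiscontinuousAction x₀, CayleyGraph.exists_isCompact_iUnion_smul,
    growthTight_of_graftable hS (CayleyGraph.dist_vertex_smul x₀)
      (H.two_pow_le_card (by omega) φ hφ) (turnClass χ)
      fun Γ hΓ hinf c => H.graftable (by omega) Γ hΓ hinf c⟩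
end

section
/- Let X be a G-space with basepoint o, let h ∈ G be strongly contracting for the action of G on X, let 𝓗 = E(h)·o be its axis, and let π_𝓗(x) := {p ∈ 𝓗 : d(x,p) = d(x,𝓗)} be the nearest-point projection to 𝓗. Then there exists B ≥ 0 such that for every g ∈ G with g ∉ E(h), diam(⋃_{y ∈ g·𝓗} π_𝓗(y)) ≤ B. -/
open Filter Metric
open scoped ENNReal

section Defs

variable {G : Type*} {X : Type*} [Group G] [MetricSpace X] [MulAction G X]

/-- The elementary closure `E(h)`: elements whose translate of the `⟨h⟩`-orbit of `o` is
coarsely equivalent to it. -/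
def Eh (o : X) (h : G) : Set G :=
  {g : G | ∃ c : ℝ, 0 ≤ c ∧
    (∀ x ∈ (g • ·) '' zOrbit o h, Metric.infDist x (zOrbit o h) ≤ c) ∧
    (∀ x ∈ zOrbit o h, Metric.infDist x ((g • ·) '' zOrbit o h) ≤ c)}

/-- The axis `𝓗 = E(h)·o` of a strongly contracting element `h`. -/
def axisSet (o : X) (h : G) : Set X := (· • o) '' Eh o h

end Defs

/-- `γ` restricts to an isometric embedding of `[a, b]`. -/
def IsometricOnIcc {X : Type*} [MetricSpace X] (γ : ℝ → X) (a b : ℝ) : Prop :=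
  ∀ s ∈ Set.Icc a b, ∀ t ∈ Set.Icc a b, dist (γ s) (γ t) = |s - t|

namespace IsometricOnIcc

variable {X : Type*} [MetricSpace X] {γ : ℝ → X} {a b : ℝ}

lemma mono (hγ : IsometricOnIcc γ a b) {a' b' : ℝ} (ha : a ≤ a') (hb : b' ≤ b) :
    IsometricOnIcc γ a' b' := fun s hs t ht =>
  hγ s ⟨ha.trans hs.1, hs.2.trans hb⟩ t ⟨ha.trans ht.1, ht.2.trans hb⟩

lemma reverse (hγ : IsometricOnIcc γ a b) :
    IsometricOnIcc (fun t => γ (-t)) (-b) (-a) := by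
  intro s hs t ht
  have := hγ (-s) ⟨by linarith [hs.2], by linarith [hs.1]⟩ (-t)
    ⟨by linarith [ht.2], by linarith [ht.1]⟩
  rw [this, ← abs_neg]
  congr 1
  ring

lemma dist_eq (hγ : IsometricOnIcc γ a b) {s t : ℝ} (hs : a ≤ s) (hst : s ≤ t) (ht : t ≤ b) :
    dist (γ s) (γ t) = t - s := by
  rw [hγ s ⟨hs, hst.trans ht⟩ t ⟨hs.trans hst, ht⟩, abs_sub_comm, abs_of_nonneg (by linarith)]

lemma smul {G : Type*} [Group G] [MulAction G X] (hIso : IsometricAction G X)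
    (hγ : IsometricOnIcc γ a b) (g : G) : IsometricOnIcc (fun t => g • γ t) a b :=
  fun s hs t ht => by rw [hIso]; exact hγ s hs t ht

end IsometricOnIcc

lemma GeodesicFromTo.isometricOnIcc {X : Type*} [MetricSpace X] {γ : ℝ → X} {x y : X}
    (hγ : GeodesicFromTo γ x y) : IsometricOnIcc γ 0 (dist x y) := hγ.2.2

/-- `p` is a choice of nearest points on `A`, and it is strongly contracting with constant
`C > 0`. -/
structure ContractingProj {X : Type*} [MetricSpace X] (A : Set X) (p : X → X) (C : ℝ) : Prop where
  pos : 0 < C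
  mem : ∀ x, p x ∈ A
  le : ∀ x, ∀ a ∈ A, dist x (p x) ≤ dist x a
  contr : ∀ x y, dist x y < dist x (p x) - C → dist (p x) (p y) ≤ C

namespace ContractingProj

variable {X : Type*} [MetricSpace X] {A : Set X} {p : X → X} {C : ℝ} {γ : ℝ → X} {a b : ℝ}

lemma dist_proj_le_add (hP : ContractingProj A p C) (x y : X) :
    dist x (p x) ≤ dist x y + dist y (p y) :=
  (hP.le x _ (hP.mem y)).trans (dist_triangle _ _ _)

lemma dist_proj_proj_le (hP : ContractingProj A p C) {x y : X} {r : ℝ} (hxy : dist x y ≤ r) :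
    dist (p x) (p y) ≤ 4 * r + 2 * C := by
  have h0 : 0 ≤ dist x y := dist_nonneg
  have hC := hP.pos
  by_cases hx : dist x y < dist x (p x) - C
  · linarith [hP.contr x y hx]
  · have h1 := hP.dist_proj_le_add y x
    have h2 := dist_triangle4 (p x) x y (p y)
    rw [dist_comm y x] at h1
    rw [dist_comm (p x) x] at h2
    linarith

/-- Almost nearest points are close to nearest points. -/
lemma dist_proj_le_of_almost_nearest (hP : ContractingProj A p C) (hGeo : GeodesicSpace X)
    {x q : X} (hq : q ∈ A) {r : ℝ} (hr : 0 ≤ r) (hxq : dist x q ≤ dist x (p x) + r) :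
    dist q (p x) ≤ 5 * C + 2 * r := by
  have hC := hP.pos
  by_cases hx : dist x (p x) ≤ 2 * C
  · have := dist_triangle_left q (p x) x
    linarith
  · push Not at hx
    obtain ⟨γ, h0, h1, hγ⟩ := hGeo x q
    have hle := hP.le x q hq
    have hm : 0 ≤ dist x (p x) - 2 * C := by linarith
    have e1 := IsometricOnIcc.dist_eq hγ le_rfl hm (by linarith)
    have e2 := IsometricOnIcc.dist_eq hγ hm (by linarith) le_rfl
    set z := γ (dist x (p x) - 2 * C)
    rw [h0] at e1
    rw [h1] at e2
    have h2 := hP.contr x z (by linarith)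
    have h3 := hP.le z q hq
    have h4 := dist_triangle4 q z (p z) (p x)
    rw [dist_comm q z, dist_comm (p z)] at h4
    linarith

lemma dist_proj_le_nat_mul (hP : ContractingProj A p C) (n : ℕ) :
    ∀ a b : ℝ, a ≤ b → b - a ≤ n * (2 * C) → IsometricOnIcc γ a b →
      (∀ t ∈ Set.Ico a b, 4 * C ≤ dist (γ t) (p (γ t))) →
      dist (p (γ a)) (p (γ b)) ≤ n * C := by
  have hC := hP.pos
  induction n with
  | zero =>
    intro a b hab hn _ _
    have : a = b := by
      push_cast at hn
      linarith
    simp [this]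
  | succ n ih =>
    intro a b hab hn hγ hfar
    push_cast at hn ⊢
    rcases hab.eq_or_lt with rfl | hlt
    · simp only [dist_self]
      positivity
    have ham : a ≤ min (a + 2 * C) b := le_min (by linarith) hab
    have hmb : min (a + 2 * C) b ≤ b := min_le_right _ _
    have hma : min (a + 2 * C) b ≤ a + 2 * C := min_le_left _ _
    have hbm : b - min (a + 2 * C) b ≤ n * (2 * C) := by
      rcases min_choice (a + 2 * C) b with h | h <;> rw [h]
      · linarith
      · rw [sub_self]
        positivity
    set m := min (a + 2 * C) b
    have h1 := ih m b hmb hbm (hγ.mono ham le_rfl) fun t ht => hfar t ⟨ham.trans ht.1, ht.2⟩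
    have h2 : dist (p (γ a)) (p (γ m)) ≤ C := by
      apply hP.contr
      rw [hγ.dist_eq le_rfl ham hmb]
      linarith [hfar a ⟨le_rfl, hlt⟩]
    linarith [dist_triangle (p (γ a)) (p (γ m)) (p (γ b))]

lemma dist_proj_le_half_length (hP : ContractingProj A p C) (hab : a ≤ b)
    (hγ : IsometricOnIcc γ a b)
    (hfar : ∀ t ∈ Set.Ico a b, 4 * C ≤ dist (γ t) (p (γ t))) :
    dist (p (γ a)) (p (γ b)) ≤ (b - a) / 2 + C := by
  have hC := hP.pos
  have h1 := hP.dist_proj_le_nat_mul ⌈(b - a) / (2 * C)⌉₊ a b hab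
    (by rw [← div_le_iff₀ (by positivity)]; exact Nat.le_ceil _) hγ hfar
  have h2 : (⌈(b - a) / (2 * C)⌉₊ : ℝ) < (b - a) / (2 * C) + 1 :=
    Nat.ceil_lt_add_one (div_nonneg (by linarith) (by positivity))
  have h3 : ((b - a) / (2 * C) + 1) * C = (b - a) / 2 + C := by
    field_simp
  nlinarith

lemma dist_proj_le_of_first_entrance (hP : ContractingProj A p C) (hab : a ≤ b)
    (hγ : IsometricOnIcc γ a b)
    (hfar : ∀ t ∈ Set.Ico a b, 4 * C ≤ dist (γ t) (p (γ t)))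
    (hb : dist (γ b) (p (γ b)) ≤ 5 * C) :
    dist (p (γ a)) (p (γ b)) ≤ 11 * C := by
  have hC := hP.pos
  rcases hab.eq_or_lt with rfl | hlt
  · simp only [dist_self]
    positivity
  have hD := hfar a ⟨le_rfl, hlt⟩
  by_cases hshort : b - a < dist (γ a) (p (γ a)) - C
  · rw [← hγ.dist_eq le_rfl hab le_rfl] at hshort
    linarith [hP.contr _ _ hshort]
  · push Not at hshort
    have hL := dist_triangle4 (γ a) (p (γ a)) (p (γ b)) (γ b)
    rw [hγ.dist_eq le_rfl hab le_rfl, dist_comm (p (γ b)) (γ b)] at hL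
    obtain ⟨m, hm⟩ : ∃ m, m = a + (dist (γ a) (p (γ a)) - 2 * C) := ⟨_, rfl⟩
    have ham : a ≤ m := by linarith
    have hmb : m ≤ b := by linarith
    have h1 : dist (p (γ a)) (p (γ m)) ≤ C := by
      apply hP.contr
      rw [hγ.dist_eq le_rfl ham hmb]
      linarith
    have h2 := hP.dist_proj_le_half_length hmb (hγ.mono ham le_rfl)
      fun t ht => hfar t ⟨ham.trans ht.1, ht.2⟩
    linarith [dist_triangle (p (γ a)) (p (γ m)) (p (γ b))]

lemma exists_near_proj_left_of_near (hP : ContractingProj A p C)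
    (hγ : IsometricOnIcc γ a b) (hnear : ∃ t ∈ Set.Icc a b, dist (γ t) (p (γ t)) ≤ 4 * C) :
    ∃ s ∈ Set.Icc a b, dist (γ s) (p (γ a)) ≤ 16 * C := by
  have hC := hP.pos
  let S : Set ℝ := {t | t ∈ Set.Icc a b ∧ dist (γ t) (p (γ t)) ≤ 4 * C}
  have hne : S.Nonempty := hnear
  have hbdd : BddBelow S := ⟨a, fun t ht => ht.1.1⟩
  have has : a ≤ sInf S := le_csInf hne fun t ht => ht.1.1
  obtain ⟨t, ht, hts⟩ := exists_lt_of_csInf_lt hne (lt_add_of_pos_right (sInf S) hC)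
  have hst : sInf S ≤ t := csInf_le hbdd ht
  have hsb : sInf S ≤ b := hst.trans ht.1.2
  have hs : dist (γ (sInf S)) (p (γ (sInf S))) ≤ 5 * C := by
    have h1 := hP.dist_proj_le_add (γ (sInf S)) (γ t)
    rw [hγ.dist_eq has hst ht.1.2] at h1
    linarith [ht.2]
  have h2 := hP.dist_proj_le_of_first_entrance has (hγ.mono le_rfl hsb) (fun u hu => by
    by_contra! hlt
    exact absurd (csInf_le hbdd (show u ∈ S from ⟨⟨hu.1, hu.2.le.trans hsb⟩, hlt.le⟩))
      (not_le.2 hu.2)) hs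
  refine ⟨sInf S, ⟨has, hsb⟩, ?_⟩
  have h3 := dist_triangle (γ (sInf S)) (p (γ (sInf S))) (p (γ a))
  rw [dist_comm (p (γ (sInf S))) (p (γ a))] at h3
  linarith

/-- A geodesic whose endpoints have distant projections comes close to the contracting set. -/
lemma exists_near_of_dist_proj (hP : ContractingProj A p C) (hab : a ≤ b)
    (hγ : IsometricOnIcc γ a b) (hd : 10 * C < dist (p (γ a)) (p (γ b))) :
    ∃ t ∈ Set.Icc a b, dist (γ t) (p (γ t)) ≤ 4 * C := by
  by_contra! hfar
  have hC := hP.pos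
  have hDa := hfar a ⟨le_rfl, hab⟩
  have hDb := hfar b ⟨hab, le_rfl⟩
  have hL := dist_triangle4 (γ a) (p (γ a)) (p (γ b)) (γ b)
  rw [hγ.dist_eq le_rfl hab le_rfl, dist_comm (p (γ b)) (γ b)] at hL
  have left : ∀ m, a ≤ m → m ≤ b → m - a ≤ dist (γ a) (p (γ a)) - 2 * C →
      dist (p (γ a)) (p (γ m)) ≤ C := fun m h1 h2 h3 => by
    apply hP.contr
    rw [hγ.dist_eq le_rfl h1 h2]
    linarith
  have right : ∀ m, a ≤ m → m ≤ b → b - m ≤ dist (γ b) (p (γ b)) - 2 * C →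
      dist (p (γ m)) (p (γ b)) ≤ C := fun m h1 h2 h3 => by
    rw [dist_comm]
    apply hP.contr
    rw [dist_comm, hγ.dist_eq h1 h2 le_rfl]
    linarith
  obtain ⟨m, hm⟩ : ∃ m, m = min b (a + (dist (γ a) (p (γ a)) - 2 * C)) := ⟨_, rfl⟩
  have hmb : m ≤ b := hm ▸ min_le_left _ _
  have ham : a ≤ m := hm ▸ le_min hab (by linarith)
  have hma : m ≤ a + (dist (γ a) (p (γ a)) - 2 * C) := hm ▸ min_le_right _ _
  have h1 := left m ham hmb (by linarith)
  by_cases hmid : b - m ≤ dist (γ b) (p (γ b)) - 2 * C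
  · linarith [right m ham hmb hmid, dist_triangle (p (γ a)) (p (γ m)) (p (γ b))]
  · push Not at hmid
    have hm' : m = a + (dist (γ a) (p (γ a)) - 2 * C) := by
      rcases min_choice b (a + (dist (γ a) (p (γ a)) - 2 * C)) with h | h
      · linarith
      · rw [hm, h]
    obtain ⟨m₂, hm₂⟩ : ∃ m₂, m₂ = b - (dist (γ b) (p (γ b)) - 2 * C) := ⟨_, rfl⟩
    have hmm : m ≤ m₂ := by linarith
    have hm₂b : m₂ ≤ b := by linarith
    have h2 := right m₂ (ham.trans hmm) hm₂b (by linarith)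
    have h3 := hP.dist_proj_le_half_length hmm (hγ.mono ham hm₂b)
      fun t ht => (hfar t ⟨ham.trans ht.1, ht.2.le.trans hm₂b⟩).le
    linarith [dist_triangle4 (p (γ a)) (p (γ m)) (p (γ m₂)) (p (γ b))]

lemma exists_near_proj_left (hP : ContractingProj A p C) (hab : a ≤ b)
    (hγ : IsometricOnIcc γ a b) (hd : 10 * C < dist (p (γ a)) (p (γ b))) :
    ∃ s ∈ Set.Icc a b, dist (γ s) (p (γ a)) ≤ 16 * C :=
  hP.exists_near_proj_left_of_near hγ (hP.exists_near_of_dist_proj hab hγ hd)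

lemma exists_near_proj_right (hP : ContractingProj A p C) (hab : a ≤ b)
    (hγ : IsometricOnIcc γ a b) (hd : 10 * C < dist (p (γ a)) (p (γ b))) :
    ∃ s ∈ Set.Icc a b, dist (γ s) (p (γ b)) ≤ 16 * C := by
  obtain ⟨s, hs, h⟩ := hP.exists_near_proj_left (neg_le_neg hab) hγ.reverse
    (by simpa [dist_comm] using hd)
  exact ⟨-s, ⟨by linarith [hs.2], by linarith [hs.1]⟩, by simpa using h⟩

lemma dist_proj_le_of_near_both_sides (hγ : IsometricOnIcc γ a b) {t r : ℝ}
    {q : X} (hl : ∃ s ∈ Set.Icc a t, dist (γ s) q ≤ r) (hr : ∃ s ∈ Set.Icc t b, dist (γ s) q ≤ r) :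
    dist (γ t) q ≤ 3 * r := by
  obtain ⟨s, hs, h1⟩ := hl
  obtain ⟨s', hs', h2⟩ := hr
  have e1 := hγ.dist_eq hs.1 hs.2 (hs'.1.trans hs'.2)
  have e2 := hγ.dist_eq hs.1 (hs.2.trans hs'.1) hs'.2
  have h3 := dist_triangle_right (γ s) (γ s') q
  have h4 := dist_triangle_left (γ t) q (γ s)
  linarith [hs'.1]

/-- Interior points of a geodesic whose projections are far from those of both endpoints are
uniformly close to the contracting set. -/
lemma dist_proj_le_of_far_endpoints (hP : ContractingProj A p C)
    (hγ : IsometricOnIcc γ a b) {t : ℝ} (ht : t ∈ Set.Icc a b)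
    (ha : 10 * C < dist (p (γ a)) (p (γ t))) (hb : 10 * C < dist (p (γ t)) (p (γ b))) :
    dist (γ t) (p (γ t)) ≤ 48 * C := by
  have := dist_proj_le_of_near_both_sides hγ
    (hP.exists_near_proj_right ht.1 (hγ.mono le_rfl ht.2) ha)
    (hP.exists_near_proj_left ht.2 (hγ.mono ht.1 le_rfl) hb)
  linarith

/-- Contracting sets are quasi-convex. -/
lemma dist_proj_le_of_near_endpoints (hP : ContractingProj A p C)
    (hγ : IsometricOnIcc γ a b) {r : ℝ} (hr : 0 ≤ r) (ha : dist (γ a) (p (γ a)) ≤ r)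
    (hb : dist (γ b) (p (γ b)) ≤ r) {t : ℝ} (ht : t ∈ Set.Icc a b) :
    dist (γ t) (p (γ t)) ≤ 3 * (16 * C + r) := by
  have hC := hP.pos
  apply dist_proj_le_of_near_both_sides hγ
  · by_cases hd : 10 * C < dist (p (γ a)) (p (γ t))
    · obtain ⟨s, hs, h⟩ := hP.exists_near_proj_right ht.1 (hγ.mono le_rfl ht.2) hd
      exact ⟨s, hs, by linarith⟩
    · exact ⟨a, ⟨le_rfl, ht.1⟩, by linarith [dist_triangle (γ a) (p (γ a)) (p (γ t))]⟩
  · by_cases hd : 10 * C < dist (p (γ t)) (p (γ b))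
    · obtain ⟨s, hs, h⟩ := hP.exists_near_proj_left ht.2 (hγ.mono ht.1 le_rfl) hd
      exact ⟨s, hs, by linarith⟩
    · rw [dist_comm] at hd
      exact ⟨b, ⟨ht.2, le_rfl⟩, by linarith [dist_triangle (γ b) (p (γ b)) (p (γ t))]⟩

end ContractingProj

/-- A coarse intermediate value theorem. -/
lemma exists_abs_sub_le_of_coarse_steps {n : ℝ → ℝ} {a b J x y k : ℝ} (hab : a ≤ b)
    (hstep : ∀ s ∈ Set.Icc a b, ∀ t ∈ Set.Icc a b, |s - t| ≤ 1 → |n s - n t| ≤ J)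
    (hx : |n a - x| ≤ J) (hy : |n b - y| ≤ J) (hxk : x ≤ k) (hky : k ≤ y) :
    ∃ t ∈ Set.Icc a b, |n t - k| ≤ J := by
  classical
  rw [abs_le] at hx hy
  by_cases hka : k ≤ n a
  · exact ⟨a, ⟨le_rfl, hab⟩, abs_le.2 ⟨by linarith, by linarith⟩⟩
  by_cases hkb : n b < k
  · exact ⟨b, ⟨hab, le_rfl⟩, abs_le.2 ⟨by linarith, by linarith⟩⟩
  push Not at hka hkb
  have hmem : ∀ i : ℕ, min (a + i) b ∈ Set.Icc a b := fun i =>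
    ⟨le_min (by linarith [i.cast_nonneg (α := ℝ)]) hab, min_le_right _ _⟩
  have hex : ∃ i : ℕ, k ≤ n (min (a + i) b) := by
    obtain ⟨i, hi⟩ := exists_nat_ge (b - a)
    exact ⟨i, by rwa [min_eq_right (by linarith)]⟩
  obtain ⟨i, hi⟩ : ∃ i, Nat.find hex = i + 1 := by
    refine Nat.exists_eq_succ_of_ne_zero fun h0 => ?_
    have := Nat.find_spec hex
    rw [h0, Nat.cast_zero, add_zero, min_eq_left hab] at this
    linarith
  have h1 := Nat.find_spec hex
  have h2 := Nat.find_min hex (m := i) (by omega)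
  rw [hi] at h1
  push Not at h2
  have h3 := hstep _ (hmem (i + 1)) _ (hmem i) (by
    refine (abs_min_sub_min_le_max _ _ _ _).trans ?_
    push_cast
    simp)
  rw [abs_le] at h3
  exact ⟨_, hmem (i + 1), abs_le.2 ⟨by linarith, by linarith⟩⟩

/-- A geodesic with endpoints near points of a contracting quasi-geodesic passes near all
points in between. -/
lemma ContractingProj.exists_fellow_travel {X : Type*} [MetricSpace X] {u : ℤ → X} {p : X → X}
    {C M c : ℝ} (hP : ContractingProj (Set.range u) p C) (hM : 1 ≤ M) (hc : 0 ≤ c)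
    (hlow : ∀ i j : ℤ, |(i : ℝ) - j| ≤ M * (dist (u i) (u j) + c))
    (hup : ∀ i j : ℤ, dist (u i) (u j) ≤ M * |(i : ℝ) - j| + c) {r : ℝ} (hr : 0 ≤ r) :
    ∃ K : ℝ, 0 ≤ K ∧ ∀ (γ : ℝ → X) (a b : ℝ), a ≤ b → IsometricOnIcc γ a b →
      ∀ i j : ℤ, dist (γ a) (u i) ≤ r → dist (γ b) (u j) ≤ r →
      ∀ k ∈ Set.uIcc i j, ∃ t ∈ Set.Icc a b, dist (γ t) (u k) ≤ K := by
  have hC := hP.pos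
  obtain ⟨R, hR⟩ : ∃ R, R = 3 * (16 * C + r) := ⟨_, rfl⟩
  obtain ⟨J, hJ⟩ : ∃ J, J = M * (2 * R + 1 + c) := ⟨_, rfl⟩
  have hJ0 : 0 ≤ J := by rw [hJ, hR]; positivity
  refine ⟨R + (M * J + c), by rw [hR]; positivity, ?_⟩
  intro γ a b hab hγ i j hi hj k hk
  choose n hn using hP.mem
  have hnear : ∀ t ∈ Set.Icc a b, dist (γ t) (u (n (γ t))) ≤ R := fun t ht => by
    rw [hn, hR]
    exact hP.dist_proj_le_of_near_endpoints hγ hr ((hP.le _ _ ⟨i, rfl⟩).trans hi)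
      ((hP.le _ _ ⟨j, rfl⟩).trans hj) ht
  have hJle : ∀ i j : ℤ, dist (u i) (u j) ≤ 2 * R + 1 → |(i : ℝ) - j| ≤ J := fun i j hij => by
    refine (hlow i j).trans ?_
    rw [hJ]
    gcongr
  have hstep : ∀ s ∈ Set.Icc a b, ∀ t ∈ Set.Icc a b, |s - t| ≤ 1 →
      |(n (γ s) : ℝ) - n (γ t)| ≤ J := fun s hs t ht hst => by
    apply hJle
    rw [← hγ s hs t ht] at hst
    have := dist_triangle4 (u (n (γ s))) (γ s) (γ t) (u (n (γ t)))
    rw [dist_comm (u (n (γ s))) (γ s)] at this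
    linarith [hnear s hs, hnear t ht]
  have hend : ∀ t ∈ Set.Icc a b, ∀ l : ℤ, dist (γ t) (u l) ≤ r → |(n (γ t) : ℝ) - l| ≤ J :=
    fun t ht l hl => by
      apply hJle
      linarith [hnear t ht, dist_triangle_left (u (n (γ t))) (u l) (γ t)]
  have hia := hend a ⟨le_rfl, hab⟩ i hi
  have hjb := hend b ⟨hab, le_rfl⟩ j hj
  have key : ∃ t ∈ Set.Icc a b, |(n (γ t) : ℝ) - k| ≤ J := by
    rcases Set.mem_uIcc.1 hk with ⟨h1, h2⟩ | ⟨h1, h2⟩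
    · exact exists_abs_sub_le_of_coarse_steps hab hstep hia hjb
        (by exact_mod_cast h1) (by exact_mod_cast h2)
    · have flip : ∀ x y : ℝ, |-x - -y| = |x - y| := fun x y => by
        rw [← abs_neg]
        congr 1
        ring
      obtain ⟨t, ht, h⟩ := exists_abs_sub_le_of_coarse_steps (n := fun t => -(n (γ t) : ℝ))
        (x := -(i : ℝ)) (y := -(j : ℝ)) (k := -(k : ℝ)) hab
        (fun s hs t ht hst => by rw [flip]; exact hstep s hs t ht hst)
        (by rwa [flip]) (by rwa [flip])
        (neg_le_neg (by exact_mod_cast h2)) (neg_le_neg (by exact_mod_cast h1))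
      exact ⟨t, ht, by rwa [flip] at h⟩
  obtain ⟨t, ht, h⟩ := key
  refine ⟨t, ht, (dist_triangle _ (u (n (γ t))) _).trans (add_le_add (hnear t ht) ?_)⟩
  refine (hup _ _).trans ?_
  gcongr

section Orbit

variable {G X : Type*} [Group G] [MetricSpace X] [MulAction G X] {o : X} {h : G}

lemma exists_nearest_of_quasiGeodesic {u : ℤ → X} {M c : ℝ} (hM : 0 ≤ M)
    (hlow : ∀ i j : ℤ, |(i : ℝ) - j| ≤ M * (dist (u i) (u j) + c)) (x : X) :
    ∃ i, ∀ j, dist x (u i) ≤ dist x (u j) := by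
  have hfin : {i : ℤ | dist x (u i) ≤ dist x (u 0)}.Finite := by
    obtain ⟨N, hN⟩ := exists_nat_ge (M * (2 * dist x (u 0) + c))
    refine (Set.finite_Icc (-(N : ℤ)) N).subset fun i hi => ?_
    have h1 : |(i : ℝ) - (0 : ℤ)| ≤ N := by
      refine (hlow i 0).trans (le_trans ?_ hN)
      have := dist_triangle_left (u i) (u 0) x
      have hi' : dist x (u i) ≤ dist x (u 0) := hi
      gcongr
      linarith
    rw [Int.cast_zero, sub_zero, abs_le] at h1
    exact ⟨by exact_mod_cast h1.1, by exact_mod_cast h1.2⟩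
  obtain ⟨i, hi, hmin⟩ := Set.exists_min_image _ (fun i => dist x (u i)) hfin
    ⟨0, le_refl (dist x (u 0))⟩
  refine ⟨i, fun j => ?_⟩
  by_cases hj : dist x (u j) ≤ dist x (u 0)
  · exact hmin j hj
  · exact le_trans hi (not_le.1 hj).le

lemma infDist_eq_of_nearest {S : Set X} {x a : X} (ha : a ∈ S)
    (hle : ∀ b ∈ S, dist x a ≤ dist x b) : infDist x S = dist x a :=
  le_antisymm (infDist_le_dist_of_mem ha) ((le_infDist ⟨a, ha⟩).2 @hle)

lemma dist_le_of_mem_nprojSet {S : Set X} {x a b : X} (ha : a ∈ nprojSet S x) (hb : b ∈ S) :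
    dist x a ≤ dist x b := ha.2.le.trans (infDist_le_dist_of_mem hb)

lemma isBounded_nprojSet (S : Set X) (x : X) : Bornology.IsBounded (nprojSet S x) :=
  isBounded_closedBall.subset fun a (ha : a ∈ nprojSet S x) =>
    mem_closedBall'.2 (ha.2.le)

/-- The nearest-point projection to the orbit of a strongly contracting element. -/
lemma StronglyContractingElem.exists_contractingProj (hSC : StronglyContractingElem o h) :
    ∃ (p : X → X) (C M c : ℝ), ContractingProj (Set.range fun i : ℤ => h ^ i • o) p C ∧
      1 ≤ M ∧ 0 ≤ c ∧
      (∀ i j : ℤ, |(i : ℝ) - j| ≤ M * (dist (h ^ i • o) (h ^ j • o) + c)) ∧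
      (∀ i j : ℤ, dist (h ^ i • o) (h ^ j • o) ≤ M * |(i : ℝ) - j| + c) := by
  obtain ⟨-, ⟨M, c, hM, hc, hq⟩, C, hC, hcontr⟩ := hSC
  have hlow : ∀ i j : ℤ, |(i : ℝ) - j| ≤ M * (dist (h ^ i • o) (h ^ j • o) + c) := fun i j => by
    have h1 := (hq i j).1
    rw [one_div, inv_mul_eq_div, sub_le_iff_le_add, div_le_iff₀' (by linarith)] at h1
    exact h1
  choose n hn using exists_nearest_of_quasiGeodesic (u := fun i : ℤ => h ^ i • o)
    (by linarith) hlow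
  have hmem : ∀ x, h ^ n x • o ∈ nprojSet (zOrbit o h) x := fun x =>
    ⟨⟨n x, rfl⟩, (infDist_eq_of_nearest (S := zOrbit o h) (a := h ^ n x • o) ⟨n x, rfl⟩
      (by rintro _ ⟨i, rfl⟩; exact hn x i)).symm⟩
  refine ⟨fun x => h ^ n x • o, C + 1, M, c, ⟨by linarith, fun x => ⟨n x, rfl⟩, ?_, ?_⟩,
    hM, hc, hlow, fun i j => (hq i j).2⟩
  · rintro x _ ⟨i, rfl⟩
    exact hn x i
  · intro x y hxy
    refine le_trans ?_ ((hcontr x y ?_).trans (by linarith))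
    · exact dist_le_diam_of_mem ((isBounded_nprojSet _ _).union (isBounded_nprojSet _ _))
        (Or.inl (hmem x)) (Or.inr (hmem y))
    · rw [← (hmem x).2]
      linarith

lemma ContractingProj.dist_eq_infDist {A : Set X} {p : X → X} {C : ℝ}
    (hP : ContractingProj A p C) (x : X) : dist x (p x) = infDist x A :=
  (infDist_eq_of_nearest (hP.mem x) (hP.le x)).symm

/-- A relation `h ^ m * g = g * h ^ n` with `m, n ≠ 0` puts `g` in the elementary closure. -/
lemma mem_Eh_of_commensurating (hIso : IsometricAction G X) {g : G} {m n : ℤ} (hm : m ≠ 0)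
    (hn : n ≠ 0) (hg : h ^ m * g = g * h ^ n) : g ∈ Eh o h := by
  have hpow : ∀ k : ℤ, h ^ (m * k) * g = g * h ^ (n * k) := fun k => by
    have hs : SemiconjBy g (h ^ n) (h ^ m) := hg.symm
    simpa [zpow_mul, SemiconjBy, eq_comm] using hs.zpow_right k
  obtain ⟨c, hc⟩ : ∃ c, ∀ r ∈ Set.Icc 0 |n|, dist (g • h ^ r • o) o ≤ c := by
    obtain ⟨c, hc⟩ := ((Set.finite_Icc 0 |n|).image fun r => dist (g • h ^ r • o) o).bddAbove
    exact ⟨c, fun r hr => hc ⟨r, hr, rfl⟩⟩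
  obtain ⟨c', hc'⟩ : ∃ c, ∀ r ∈ Set.Icc 0 |m|, dist (h ^ r • o) (g • o) ≤ c := by
    obtain ⟨c, hc⟩ := ((Set.finite_Icc 0 |m|).image fun r => dist (h ^ r • o) (g • o)).bddAbove
    exact ⟨c, fun r hr => hc ⟨r, hr, rfl⟩⟩
  refine ⟨max c c', ?_, ?_, ?_⟩
  · exact le_max_of_le_left (dist_nonneg.trans (hc 0 ⟨le_rfl, abs_nonneg n⟩))
  · rintro _ ⟨_, ⟨i, rfl⟩, rfl⟩
    refine (infDist_le_dist_of_mem (y := h ^ (m * (i / n)) • o) (s := zOrbit o h) ⟨_, rfl⟩).trans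
      (le_max_of_le_left ?_)
    have h1 : g * h ^ i = h ^ (m * (i / n)) * (g * h ^ (i % n)) := by
      rw [← mul_assoc, hpow, mul_assoc, ← zpow_add, Int.mul_ediv_add_emod]
    have h2 : g • h ^ i • o = h ^ (m * (i / n)) • g • h ^ (i % n) • o := by
      simp only [smul_smul, h1]
    simp only [h2]
    rw [hIso]
    exact hc _ ⟨Int.emod_nonneg _ hn, (Int.emod_lt_abs _ hn).le⟩
  · rintro _ ⟨i, rfl⟩
    refine (infDist_le_dist_of_mem (y := g • h ^ (n * (i / m)) • o)
      (s := (g • ·) '' zOrbit o h) ⟨_, ⟨_, rfl⟩, rfl⟩).trans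
      (le_max_of_le_right ?_)
    have h1 : h ^ i • o = h ^ (m * (i / m)) • h ^ (i % m) • o := by
      rw [smul_smul, ← zpow_add, Int.mul_ediv_add_emod]
    have h2 : g • h ^ (n * (i / m)) • o = h ^ (m * (i / m)) • g • o := by
      simp only [smul_smul, hpow]
    simp only [h1, h2]
    rw [hIso]
    exact hc' _ ⟨Int.emod_nonneg _ hm, (Int.emod_lt_abs _ hm).le⟩

lemma zpow_mem_Eh (hIso : IsometricAction G X) (k : ℤ) : h ^ k ∈ Eh o h :=
  mem_Eh_of_commensurating hIso one_ne_zero one_ne_zero (by rw [← zpow_add, ← zpow_add, add_comm])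

lemma finite_setOf_dist_le [ProperSpace X] (hPD : ProperlyDiscontinuousAction G X) (o : X)
    {r : ℝ} (hr : 0 ≤ r) : {g : G | dist (g • o) o ≤ r}.Finite :=
  (hPD _ (isCompact_closedBall o r)).subset fun _ hg =>
    ⟨_, ⟨o, mem_closedBall_self hr, rfl⟩, mem_closedBall.2 hg⟩

/-- If a long segment of the orbit of `h` lies near its translate by `g`, then `g` is in the
elementary closure of `h`. -/
lemma exists_mem_Eh_of_long_fellow_travel [ProperSpace X] (hIso : IsometricAction G X)
    (hPD : ProperlyDiscontinuousAction G X) (hord : ¬ IsOfFinOrder h) {r : ℝ} (hr : 0 ≤ r) :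
    ∃ N : ℝ, 0 ≤ N ∧ ∀ (g : G) (a b : ℤ), N < |(a : ℝ) - b| →
      (∀ k ∈ Set.uIcc a b, ∃ j : ℤ, dist (g • h ^ j • o) (h ^ k • o) ≤ r) → g ∈ Eh o h := by
  have hfin := finite_setOf_dist_le hPD o hr
  refine ⟨hfin.toFinset.card, Nat.cast_nonneg _, fun g a b hab hnear => ?_⟩
  choose! j hj using hnear
  have hcard : hfin.toFinset.card < (Finset.uIcc a b).card := by
    rw [Int.card_uIcc]
    have : (hfin.toFinset.card : ℤ) < |a - b| := by exact_mod_cast hab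
    rw [abs_sub_comm, Int.abs_eq_natAbs] at this
    omega
  obtain ⟨k, hk, l, hl, hkl, heq⟩ := Finset.exists_ne_map_eq_of_card_lt_of_maps_to hcard
    (f := fun k => (h ^ k)⁻¹ * g * h ^ j k) (fun k hk => by
      have hk' := hj k (by simpa using hk)
      simp only [Set.Finite.coe_toFinset, Set.mem_ofPred_eq]
      rwa [← hIso (h ^ k), ← smul_smul, ← smul_smul, smul_inv_smul])
  have hinj := injective_zpow_iff_not_isOfFinOrder.2 hord
  have hrel : h ^ (k - l) * g = g * h ^ (j k - j l) := by
    have := congrArg (fun x => h ^ k * x * (h ^ j l)⁻¹) heq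
    simpa [zpow_sub, mul_assoc] using this.symm
  refine mem_Eh_of_commensurating hIso (sub_ne_zero.2 hkl) ?_ hrel
  intro h0
  rw [h0, zpow_zero, mul_one, mul_eq_right] at hrel
  exact sub_ne_zero.2 hkl (hinj (by simpa using hrel))

/-- The axis of `h` lies in a bounded neighbourhood of the orbit of `h`. -/
lemma exists_axis_near_orbit (hGeo : GeodesicSpace X) (hIso : IsometricAction G X)
    {p : X → X} {C M c : ℝ} (hP : ContractingProj (Set.range fun i : ℤ => h ^ i • o) p C)
    (hM : 1 ≤ M) (hc : 0 ≤ c)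
    (hlow : ∀ i j : ℤ, |(i : ℝ) - j| ≤ M * (dist (h ^ i • o) (h ^ j • o) + c))
    (hup : ∀ i j : ℤ, dist (h ^ i • o) (h ^ j • o) ≤ M * |(i : ℝ) - j| + c) :
    ∃ D : ℝ, 0 ≤ D ∧ ∀ g ∈ Eh o h, dist (g • o) (p (g • o)) ≤ D := by
  have hC := hP.pos
  obtain ⟨K, hK, hfellow⟩ := hP.exists_fellow_travel hM hc hlow hup le_rfl
  refine ⟨K + 48 * C, by positivity, ?_⟩
  rintro g ⟨r, hr, hg, -⟩
  have hgr : ∀ i : ℤ, dist (g • h ^ i • o) (p (g • h ^ i • o)) ≤ r := fun i => by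
    rw [hP.dist_eq_infDist]
    exact hg _ ⟨_, ⟨i, rfl⟩, rfl⟩
  have hgo : dist (g • o) (p (g • o)) ≤ r := by simpa using hgr 0
  obtain ⟨n, hn⟩ := exists_nat_gt (M * (10 * C + 2 * r + 2 * K + c))
  obtain ⟨γ, h0, h1, hγ⟩ := hGeo (h ^ (-n : ℤ) • o) (h ^ (n : ℤ) • o)
  obtain ⟨t, ht, hto⟩ := hfellow γ _ _ dist_nonneg hγ (-n) n
    (by rw [h0, dist_self]) (by rw [h1, dist_self]) 0
    (Set.mem_uIcc.2 (Or.inl ⟨by omega, by omega⟩))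
  rw [zpow_zero, one_smul] at hto
  have hgto : dist (g • γ t) (g • o) ≤ K := by rwa [hIso]
  have hfar : ∀ i : ℤ, |(i : ℝ)| = n →
      10 * C < dist (p (g • h ^ i • o)) (p (g • γ t)) := fun i hi => by
    have e1 := hlow i 0
    rw [Int.cast_zero, sub_zero, hi, zpow_zero, one_smul, ← hIso g] at e1
    have e2 := lt_of_mul_lt_mul_left (hn.trans_le e1) (by linarith)
    have e3 := hP.dist_proj_le_add (g • γ t) (g • o)
    have e4 := dist_triangle (g • h ^ i • o) (g • γ t) (g • o)
    have e5 := dist_triangle4 (g • h ^ i • o) (p (g • h ^ i • o)) (p (g • γ t)) (g • γ t)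
    rw [dist_comm (p (g • γ t)) (g • γ t)] at e5
    linarith [hgr i]
  have hmid := hP.dist_proj_le_of_far_endpoints (IsometricOnIcc.smul hIso hγ g) ht
    (by rw [h0]; exact hfar _ (by simp))
    (by rw [h1, dist_comm]; exact hfar _ (by simp))
  have := hP.dist_proj_le_add (g • o) (g • γ t)
  rw [dist_comm (g • o) (g • γ t)] at this
  linarith

/-- Translates of the orbit of `h` by elements outside `E(h)` have uniformly bounded
projections. -/
lemma exists_bound_dist_proj_translate [ProperSpace X] (hGeo : GeodesicSpace X)
    (hIso : IsometricAction G X) (hPD : ProperlyDiscontinuousAction G X)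
    (hord : ¬ IsOfFinOrder h)
    {p : X → X} {C M c : ℝ} (hP : ContractingProj (Set.range fun i : ℤ => h ^ i • o) p C)
    (hM : 1 ≤ M) (hc : 0 ≤ c)
    (hlow : ∀ i j : ℤ, |(i : ℝ) - j| ≤ M * (dist (h ^ i • o) (h ^ j • o) + c))
    (hup : ∀ i j : ℤ, dist (h ^ i • o) (h ^ j • o) ≤ M * |(i : ℝ) - j| + c) :
    ∃ B : ℝ, 0 ≤ B ∧ ∀ g ∉ Eh o h, ∀ i j : ℤ,
      dist (p (g • h ^ i • o)) (p (g • h ^ j • o)) ≤ B := by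
  have hC := hP.pos
  obtain ⟨K, hK, hfellow⟩ := hP.exists_fellow_travel hM hc hlow hup
    (r := 16 * C) (by positivity)
  obtain ⟨N, hN, hlong⟩ := exists_mem_Eh_of_long_fellow_travel (o := o) hIso hPD hord
    (r := K + 48 * C) (by positivity)
  refine ⟨max (10 * C) (M * N + c), le_max_of_le_left (by positivity), fun g hg i j => ?_⟩
  by_contra! hfar
  rw [max_lt_iff] at hfar
  obtain ⟨γ₀, h0, h1, hγ₀⟩ := hGeo (h ^ i • o) (h ^ j • o)
  have hL : (0 : ℝ) ≤ dist (h ^ i • o) (h ^ j • o) := dist_nonneg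
  set L := dist (h ^ i • o) (h ^ j • o)
  have hγ := IsometricOnIcc.smul hIso (a := 0) (b := L) hγ₀ g
  have hd : 10 * C < dist (p (g • γ₀ 0)) (p (g • γ₀ L)) := by rw [h0, h1]; exact hfar.1
  obtain ⟨s, hs, hsp⟩ := hP.exists_near_proj_left hL hγ hd
  obtain ⟨t, ht, htp⟩ := hP.exists_near_proj_right hL hγ hd
  obtain ⟨a, ha⟩ := hP.mem (g • γ₀ 0)
  obtain ⟨b, hb⟩ := hP.mem (g • γ₀ L)
  rw [← ha] at hsp
  rw [← hb] at htp
  have htravel : ∀ k ∈ Set.uIcc a b, ∃ v ∈ Set.Icc 0 L, dist (g • γ₀ v) (h ^ k • o) ≤ K := by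
    intro k hk
    rcases le_total s t with hst | hts
    · obtain ⟨v, hv, hvk⟩ := hfellow _ s t hst (hγ.mono hs.1 ht.2) a b hsp htp k hk
      exact ⟨v, ⟨hs.1.trans hv.1, hv.2.trans ht.2⟩, hvk⟩
    · obtain ⟨v, hv, hvk⟩ := hfellow _ t s hts (hγ.mono ht.1 hs.2) b a htp hsp k
        (Set.uIcc_comm a b ▸ hk)
      exact ⟨v, ⟨ht.1.trans hv.1, hv.2.trans hs.2⟩, hvk⟩
  refine hg (hlong g a b ?_ fun k hk => ?_)
  · have e1 : M * N + c < M * |(a : ℝ) - b| + c := by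
      refine lt_of_lt_of_le ?_ (hup a b)
      simp only at ha hb
      rw [ha, hb, h0, h1]
      exact hfar.2
    exact lt_of_mul_lt_mul_left (lt_of_add_lt_add_right e1) (by linarith)
  · obtain ⟨v, hv, hvk⟩ := htravel k hk
    have hq := hP.dist_proj_le_of_near_endpoints (r := 0) hγ₀ le_rfl
      (by simpa [h0] using hP.le (h ^ i • o) _ ⟨i, rfl⟩)
      (by simpa [h1] using hP.le (h ^ j • o) _ ⟨j, rfl⟩) hv
    obtain ⟨l, hl⟩ := hP.mem (γ₀ v)
    refine ⟨l, ?_⟩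
    rw [← hl, ← hIso g, dist_comm] at hq
    linarith [dist_triangle (g • h ^ l • o) (g • γ₀ v) (h ^ k • o)]

end Orbit

/-- **Lemma (Axiom (P0)).** If `h` is strongly contracting with axis `𝓗`, then the
nearest-point projections to `𝓗` of the translates `g·𝓗`, `g ∉ E(h)`, have uniformly
bounded diameter. -/
theorem bounded_projection_of_translated_axis
    {G X : Type*} [Group G] [MetricSpace X] [MulAction G X] (o : X)
    (hProp : ProperSpace X) (hGeo : GeodesicSpace X)
    (hIso : IsometricAction G X) (hPD : ProperlyDiscontinuousAction G X)
    (h : G) (hSC : StronglyContractingElem o h) :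
    ∃ B : ℝ, 0 ≤ B ∧ ∀ g : G, g ∉ Eh o h →
      Metric.diam (⋃ y ∈ (g • ·) '' axisSet o h, nprojSet (axisSet o h) y) ≤ B := by
  obtain ⟨p, C, M, c, hP, hM, hc, hlow, hup⟩ := hSC.exists_contractingProj
  obtain ⟨D, hD, haxis⟩ := exists_axis_near_orbit hGeo hIso hP hM hc hlow hup
  obtain ⟨B, hB, hproj⟩ := exists_bound_dist_proj_translate hGeo hIso hPD hSC.1 hP hM hc hlow hup
  have hC := hP.pos
  have hnear : ∀ g : G, g ∉ Eh o h → ∀ y ∈ (g • ·) '' axisSet o h,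
      ∀ q ∈ nprojSet (axisSet o h) y, ∃ i : ℤ,
        dist q (p (g • h ^ i • o)) ≤ 7 * D + 7 * C := by
    rintro g - _ ⟨_, ⟨e, he, rfl⟩, rfl⟩ q hq
    obtain ⟨f, hf, rfl⟩ := hq.1
    obtain ⟨i, hi⟩ := hP.mem (e • o)
    have h1 := haxis e he
    have h2 := haxis f hf
    simp only at hi h2
    have h3 := hP.dist_proj_proj_le (x := g • e • o) (y := g • h ^ i • o) (r := D)
      (by rwa [hIso, hi])
    obtain ⟨k, hk⟩ := hP.mem (g • e • o)
    have h4 : dist (g • e • o) (f • o) ≤ dist (g • e • o) (p (g • e • o)) :=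
      dist_le_of_mem_nprojSet hq (hk ▸ ⟨h ^ k, zpow_mem_Eh hIso k, rfl⟩)
    have h5 := hP.dist_proj_le_of_almost_nearest hGeo (x := g • e • o) (hP.mem (f • o)) hD
      (by linarith [dist_triangle (g • e • o) (f • o) (p (f • o))])
    exact ⟨i, by linarith [dist_triangle4 (f • o) (p (f • o)) (p (g • e • o)) (p (g • h ^ i • o))]⟩
  refine ⟨B + 2 * (7 * D + 7 * C), by positivity, fun g hg => ?_⟩
  refine diam_le_of_forall_dist_le (by positivity) fun q hq q' hq' => ?_
  simp only [Set.mem_iUnion] at hq hq'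
  obtain ⟨y, hy, hq⟩ := hq
  obtain ⟨y', hy', hq'⟩ := hq'
  obtain ⟨i, hi⟩ := hnear g hg y hy q hq
  obtain ⟨j, hj⟩ := hnear g hg y' hy' q' hq'
  have := dist_triangle4 q (p (g • h ^ i • o)) (p (g • h ^ j • o)) q'
  rw [dist_comm (p (g • h ^ j • o)) q'] at this
  linarith [hproj g hg i j]
end
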